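/- arXiv:2108.11940 — 2 statements merged into one kernel-verified Lean document; each statement's English description precedes it below -/
import Mathlib

section
/- For every t > 0 and every x = (x_h,x₃) ∈ ℝ³, the following three quantities are equal, and the two Fourier integrals below converge absolutely: (2π)^{−3}∫_{ℝ³} e^{i x·ξ} |ξ|^{−2} e^{−t|ξ_h|²} dξ = (2π)^{−2}∫_{ℝ²} e^{i x_h·ξ_h} (2|ξ_h|)^{−1} e^{−t|ξ_h|²} e^{−|ξ_h||x₃|} dξ_h = ∫₀^∞ G_h(t+s,x_h) G_v(s,x₃) ds. -/
open MeasureTheory Real Filter Topology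
open scoped ENNReal

noncomputable section

/-- ℝ³, written as (horizontal plane) × (vertical line). -/
abbrev V3 : Type := (ℝ × ℝ) × ℝ

/-- Partial derivative ∂₁ on ℝ³. -/
def pd1 (f : V3 → ℝ) : V3 → ℝ := fun x => fderiv ℝ f x ((1, 0), 0)
/-- Partial derivative ∂₂ on ℝ³. -/
def pd2 (f : V3 → ℝ) : V3 → ℝ := fun x => fderiv ℝ f x ((0, 1), 0)
/-- Partial derivative ∂₃ on ℝ³. -/
def pd3 (f : V3 → ℝ) : V3 → ℝ := fun x => fderiv ℝ f x ((0, 0), 1)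

/-- Iterated derivative ∇^α = ∂₁^{α₁}∂₂^{α₂}∂₃^{α₃} for a multi-index α = ((α₁,α₂),α₃). -/
def Dmul (α : (ℕ × ℕ) × ℕ) (f : V3 → ℝ) : V3 → ℝ :=
  pd1^[α.1.1] (pd2^[α.1.2] (pd3^[α.2] f))

/-- Total order |α| of a multi-index. -/
def mOrder (α : (ℕ × ℕ) × ℕ) : ℕ := α.1.1 + α.1.2 + α.2
/-- Horizontal order |α_h| of a multi-index. -/
def hOrder (α : (ℕ × ℕ) × ℕ) : ℕ := α.1.1 + α.1.2

/-- Partial derivative ∂₁ on ℝ². -/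
def pdh1 (g : ℝ × ℝ → ℝ) : ℝ × ℝ → ℝ := fun x => fderiv ℝ g x (1, 0)
/-- Partial derivative ∂₂ on ℝ². -/
def pdh2 (g : ℝ × ℝ → ℝ) : ℝ × ℝ → ℝ := fun x => fderiv ℝ g x (0, 1)
/-- Iterated horizontal derivative ∇_h^β on ℝ². -/
def DmulH (β : ℕ × ℕ) (g : ℝ × ℝ → ℝ) : ℝ × ℝ → ℝ := pdh1^[β.1] (pdh2^[β.2] g)

/-- The 2D Gaussian G_h(t,x_h) = (4πt)⁻¹ exp(-|x_h|²/(4t)). -/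
def Gh (t : ℝ) (xh : ℝ × ℝ) : ℝ :=
  (4 * π * t)⁻¹ * Real.exp (-(xh.1 ^ 2 + xh.2 ^ 2) / (4 * t))

/-- The 1D Gaussian G_v(s,y) = (4πs)^{-1/2} exp(-y²/(4s)). -/
def Gv (s : ℝ) (y : ℝ) : ℝ :=
  (Real.sqrt (4 * π * s))⁻¹ * Real.exp (-(y ^ 2) / (4 * s))

/-- The horizontal heat semigroup e^{tΔ_h} acting on functions on ℝ³. -/
def heatH (t : ℝ) (f : V3 → ℝ) : V3 → ℝ :=
  fun x => ∫ y : ℝ × ℝ, Gh t (x.1 - y) * f (y, x.2)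

/-- The kernel K(t,x) = ∫₀^∞ G_h(t+s,x_h) G_v(s,x₃) ds. -/
def Kker (t : ℝ) (x : V3) : ℝ :=
  ∫ s in Set.Ioi (0 : ℝ), Gh (t + s) x.1 * Gv s x.2

/-- The derivative kernel ∇_h^β(−Δ_h)^{γ/2}K, via its Fourier integral. -/
def KD (β : ℕ × ℕ) (γ : ℕ) (t : ℝ) (x : V3) : ℝ :=
  (((2 * π) ^ 2)⁻¹ : ℝ) *
    (∫ ξ : ℝ × ℝ,
      Complex.exp (Complex.I * ((x.1.1 * ξ.1 + x.1.2 * ξ.2 : ℝ) : ℂ)) *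
        (Complex.I * (ξ.1 : ℂ)) ^ β.1 * (Complex.I * (ξ.2 : ℂ)) ^ β.2 *
        ((Real.sqrt (ξ.1 ^ 2 + ξ.2 ^ 2) : ℂ) ^ ((γ : ℤ) - 1)) * (1 / 2 : ℂ) *
        ((Real.exp (-t * (ξ.1 ^ 2 + ξ.2 ^ 2)) : ℝ) : ℂ) *
        ((Real.exp (-(Real.sqrt (ξ.1 ^ 2 + ξ.2 ^ 2)) * |x.2|) : ℝ) : ℂ)).re

/-- The kernel ∇_h^β(−Δ_h)^{γ/2}K̃(t,x) = sgn(x₃)·∇_h^β(−Δ_h)^{γ/2}K(t,x). -/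
def KDt (β : ℕ × ℕ) (γ : ℕ) (t : ℝ) (x : V3) : ℝ := Real.sign x.2 * KD β γ t x

/-- The kernels K^{(1)} = ∇_h^β(−Δ_h)^{γ/2}K and K^{(2)} = sgn(x₃)∇_h^β(−Δ_h)^{γ/2}K. -/
def Km (m : ℕ) (β : ℕ × ℕ) (γ : ℕ) : ℝ → V3 → ℝ := if m = 1 then KD β γ else KDt β γ

/-- Convolution on ℝ³. -/
def conv3 (f g : V3 → ℝ) : V3 → ℝ := fun x => ∫ y : V3, f (x - y) * g y

/-- The horizontal weight |x_h|. -/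
def wxh (x : V3) : ℝ := Real.sqrt (x.1.1 ^ 2 + x.1.2 ^ 2)

/-- ℝ≥0∞-valued L^p norm of an ℝ≥0∞-valued function. -/
def lpn {α : Type*} [MeasurableSpace α] (p : ℝ≥0∞) (μ : Measure α) (g : α → ℝ≥0∞) : ℝ≥0∞ :=
  if p = ∞ then essSup g μ else (∫⁻ a, g a ^ p.toReal ∂μ) ^ (1 / p.toReal)

/-- The anisotropic norm L_h^p L_v^q on ℝ³. -/
def LhLv (p q : ℝ≥0∞) (f : V3 → ℝ) : ℝ≥0∞ :=
  lpn p (volume : Measure (ℝ × ℝ)) fun xh =>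
    lpn q (volume : Measure ℝ) fun y => ENNReal.ofReal |f (xh, y)|

/-- Multi-indices of order at most s. -/
def idxs (s : ℕ) : Finset ((ℕ × ℕ) × ℕ) :=
  ((Finset.range (s + 1) ×ˢ Finset.range (s + 1)) ×ˢ Finset.range (s + 1)).filter
    fun α => mOrder α ≤ s

/-- The H^s(ℝ³) norm: sum of the L² norms of all derivatives of order ≤ s. -/
def HsNorm (s : ℕ) (f : V3 → ℝ) : ℝ≥0∞ :=
  ∑ α ∈ idxs s, eLpNorm (Dmul α f) 2 (volume : Measure V3)

/-- Horizontal components of a vector field. -/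
def hcV (v : V3 → V3) (j : Fin 2) : V3 → ℝ :=
  fun x => if j = 0 then (v x).1.1 else (v x).1.2
/-- Components of a vector field. -/
def c3V (v : V3 → V3) (k : Fin 3) : V3 → ℝ :=
  fun x => if k = 0 then (v x).1.1 else if k = 1 then (v x).1.2 else (v x).2

/-- The X^s norm of a scalar function. -/
def XsNorm (s : ℕ) (f : V3 → ℝ) : ℝ≥0∞ :=
  HsNorm s f + (LhLv 1 1 f + LhLv 1 1 (pd3 f)) + (LhLv 1 ∞ f + LhLv 1 ∞ (pd3 f))

/-- The X^s norm of a vector field. -/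
def XsNormV (s : ℕ) (v : V3 → V3) : ℝ≥0∞ := ∑ k : Fin 3, XsNorm s (c3V v k)
/-- The H^s norm of a vector field. -/
def HsNormV (s : ℕ) (v : V3 → V3) : ℝ≥0∞ := ∑ k : Fin 3, HsNorm s (c3V v k)
/-- The L¹(ℝ²_{x_h};(W^{1,1}∩W^{1,∞})(ℝ_{x₃})) norm of a vector field. -/
def L1WNormV (v : V3 → V3) : ℝ≥0∞ :=
  ∑ k : Fin 3, ((LhLv 1 1 (c3V v k) + LhLv 1 1 (pd3 (c3V v k))) +
    (LhLv 1 ∞ (c3V v k) + LhLv 1 ∞ (pd3 (c3V v k))))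

/-- The weighted X̃^s norm of a vector field. -/
def XtNormV (s : ℕ) (v : V3 → V3) : ℝ≥0∞ :=
  XsNormV s v + ∑ k : Fin 3, (LhLv 1 1 (fun x => wxh x * c3V v k x) +
    LhLv 1 ∞ (fun x => wxh x * c3V v k x))

/-- Divergence free in the sense of distributions. -/
def DivFree (v : V3 → V3) : Prop :=
  ∀ φ : V3 → ℝ, ContDiff ℝ (⊤ : ℕ∞) φ → HasCompactSupport φ →
    ∫ x : V3, ((v x).1.1 * pd1 φ x + (v x).1.2 * pd2 φ x + (v x).2 * pd3 φ x) = 0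

/-- Horizontal unit multi-indices. -/
def eh (j : Fin 2) : ℕ × ℕ := if j = 0 then (1, 0) else (0, 1)
/-- Horizontal partial derivative in the j-th direction. -/
def hd (j : Fin 2) : (V3 → ℝ) → V3 → ℝ := if j = 0 then pd1 else pd2

/-- Duhamel term 𝒟ʰ₁[u], j-th horizontal component. -/
def Dh1 (u : ℝ → V3 → V3) (j : Fin 2) (t : ℝ) (x : V3) : ℝ :=
  -∫ τ in Set.Ioc (0 : ℝ) t,
    heatH (t - τ) (pd3 fun z => c3V (u τ) 2 z * hcV (u τ) j z) x

/-- Duhamel term 𝒟ʰ₂[u], j-th horizontal component. -/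
def Dh2 (u : ℝ → V3 → V3) (j : Fin 2) (t : ℝ) (x : V3) : ℝ :=
  -∫ τ in Set.Ioc (0 : ℝ) t,
    heatH (t - τ) (fun z =>
      pd1 (fun y => hcV (u τ) 0 y * hcV (u τ) j y) z +
      pd2 (fun y => hcV (u τ) 1 y * hcV (u τ) j y) z) x

/-- Duhamel term 𝒟ʰ₃[u], j-th horizontal component. -/
def Dh3 (u : ℝ → V3 → V3) (j : Fin 2) (t : ℝ) (x : V3) : ℝ :=
  ∫ τ in Set.Ioc (0 : ℝ) t, hd j (heatH (t - τ) fun z => c3V (u τ) 2 z ^ 2) x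

/-- Duhamel term 𝒟ʰ₄[u], j-th horizontal component. -/
def Dh4 (u : ℝ → V3 → V3) (j : Fin 2) (t : ℝ) (x : V3) : ℝ :=
  -∫ τ in Set.Ioc (0 : ℝ) t,
    ∑ k : Fin 2, ∑ l : Fin 2,
      conv3 (KD (eh j + eh k + eh l) 0 (t - τ)) (fun z => hcV (u τ) k z * hcV (u τ) l z) x

/-- Duhamel term 𝒟ʰ₅[u], j-th horizontal component. -/
def Dh5 (u : ℝ → V3 → V3) (j : Fin 2) (t : ℝ) (x : V3) : ℝ :=
  (∫ τ in Set.Ioc (0 : ℝ) t,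
    ∑ k : Fin 2,
      2 * conv3 (KDt (eh j + eh k) 1 (t - τ)) (fun z => c3V (u τ) 2 z * hcV (u τ) k z) x) -
  ∫ τ in Set.Ioc (0 : ℝ) t,
    conv3 (KD (eh j) 2 (t - τ)) (fun z => c3V (u τ) 2 z ^ 2) x

/-- Duhamel term 𝒟ᵛ₁[u]. -/
def Dv1 (u : ℝ → V3 → V3) (t : ℝ) (x : V3) : ℝ :=
  ∫ τ in Set.Ioc (0 : ℝ) t,
    heatH (t - τ) (fun z =>
      pd1 (fun y => c3V (u τ) 2 y * hcV (u τ) 0 y) z +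
      pd2 (fun y => c3V (u τ) 2 y * hcV (u τ) 1 y) z) x

/-- Duhamel term 𝒟ᵛ₂[u]. -/
def Dv2 (u : ℝ → V3 → V3) (t : ℝ) (x : V3) : ℝ :=
  ∫ τ in Set.Ioc (0 : ℝ) t,
    ∑ k : Fin 2, ∑ l : Fin 2,
      conv3 (KDt (eh k + eh l) 1 (t - τ)) (fun z => hcV (u τ) k z * hcV (u τ) l z) x

/-- Duhamel term 𝒟ᵛ₃[u]. -/
def Dv3 (u : ℝ → V3 → V3) (t : ℝ) (x : V3) : ℝ :=
  (-∫ τ in Set.Ioc (0 : ℝ) t,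
    ∑ k : Fin 2,
      2 * conv3 (KD (eh k) 2 (t - τ)) (fun z => c3V (u τ) 2 z * hcV (u τ) k z) x) +
  ∫ τ in Set.Ioc (0 : ℝ) t,
    conv3 (KDt (0, 0) 3 (t - τ)) (fun z => c3V (u τ) 2 z ^ 2) x

/-- Mild solution of the 3D Navier–Stokes equations with horizontal viscosity. -/
def IsMildSolution (u0 : V3 → V3) (u : ℝ → V3 → V3) : Prop :=
  ∀ t : ℝ, 0 < t → ∀ x : V3,
    (∀ j : Fin 2,
      hcV (u t) j x =
        heatH t (hcV u0 j) x + Dh1 u j t x + Dh2 u j t x + Dh3 u j t x +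
          Dh4 u j t x + Dh5 u j t x) ∧
    c3V (u t) 2 x = heatH t (c3V u0 2) x + Dv1 u t x + Dv2 u t x + Dv3 u t x

/-- u ∈ C([0,∞); X^s(ℝ³)). -/
def InCXs (s : ℕ) (u : ℝ → V3 → V3) : Prop :=
  (∀ t : ℝ, 0 ≤ t → XsNormV s (u t) < ∞) ∧
  ∀ t₀ : ℝ, 0 ≤ t₀ →
    Tendsto (fun t => XsNormV s fun x => u t x - u t₀ x) (nhdsWithin t₀ (Set.Ici 0)) (nhds 0)

/-- The energy bound ‖u(t)‖_{H^s} ≤ √2 ‖u₀‖_{H^s}. -/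
def EnergyBound (s : ℕ) (u0 : V3 → V3) (u : ℝ → V3 → V3) : Prop :=
  ∀ t : ℝ, 0 ≤ t → HsNormV s (u t) ≤ ENNReal.ofReal (Real.sqrt 2) * HsNormV s u0

/-- Assumptions (A1)–(A2) with parameters s, T, A. -/
def SatA1A2 (s : ℕ) (T : ℝ≥0∞) (A : ℝ) (u : ℝ → V3 → V3) : Prop :=
  InCXs s u ∧ (∀ t : ℝ, DivFree (u t)) ∧
  (∀ t : ℝ, 0 < t →
    HsNormV s (u t) ≤ ENNReal.ofReal A ∧ L1WNormV (u t) ≤ ENNReal.ofReal (A * (1 + t))) ∧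
  (∀ p : ℝ≥0∞, 1 ≤ p → ∀ t : ℝ, 0 < t → ENNReal.ofReal t < T →
    ∀ α : (ℕ × ℕ) × ℕ, mOrder α ≤ 1 →
      (∀ j : Fin 2,
        eLpNorm (Dmul α (hcV (u t) j)) p (volume : Measure V3) ≤
          ENNReal.ofReal (A * t ^ (-(1 - p.toReal⁻¹) - (hOrder α : ℝ) / 2))) ∧
      eLpNorm (Dmul (α.1, 0) (c3V (u t) 2)) p (volume : Measure V3) ≤
        ENNReal.ofReal (A * t ^ (-(3 / 2 : ℝ) * (1 - p.toReal⁻¹) - (hOrder α : ℝ) / 2)))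

/-- Assumption (A3) with constant A on (0,T). -/
def SatA3 (T : ℝ≥0∞) (A : ℝ) (u : ℝ → V3 → V3) : Prop :=
  ∀ t : ℝ, 0 < t → ENNReal.ofReal t < T →
    ∀ α : (ℕ × ℕ) × ℕ, mOrder α ≤ 1 → ∀ k : Fin 3,
      LhLv ∞ 1 (Dmul α (c3V (u t) k)) ≤ ENNReal.ofReal (A * t ^ (-1 - (hOrder α : ℝ) / 2))

/-- Assumption (A4) with constant B. -/
def SatA4 (B : ℝ) (u : ℝ → V3 → V3) : Prop :=
  ∀ t : ℝ, 0 < t →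
    (∀ j : Fin 2,
      LhLv 1 ∞ (fun x => wxh x * hcV (u t) j x) ≤
        ENNReal.ofReal (B * (1 + t) ^ ((1 : ℝ) / 2))) ∧
    LhLv 1 ∞ (fun x => wxh x * c3V (u t) 2 x) ≤ ENNReal.ofReal B

/-- Horizontal multi-indices of order at most m. -/
def hIdx (m : ℕ) : Finset (ℕ × ℕ) :=
  (Finset.range (m + 1) ×ˢ Finset.range (m + 1)).filter fun β => β.1 + β.2 ≤ m

theorem aux_ftc (F f : ℝ → ℝ) (L m : ℝ) (h0 : Tendsto F (𝓝[>] 0) (𝓝 L))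
    (hd : ∀ s ∈ Set.Ioi (0:ℝ), HasDerivAt F (f s) s) (hp : ∀ s ∈ Set.Ioi (0:ℝ), 0 ≤ f s)
    (hm : Tendsto F atTop (𝓝 m)) : ∫ s in Set.Ioi (0:ℝ), f s = m - L := by
  have key := integral_Ioi_of_hasDerivAt_of_nonneg (g := Function.update F 0 L) (g' := f)
    (a := 0) (l := m) ?_ ?_ hp ?_
  · simpa using key
  · rw [continuousWithinAt_update_same, show Set.Ici (0:ℝ) \ {0} = Set.Ioi 0 from Set.Ici_sdiff_left]
    exact h0
  · intro s hs
    refine (hd s hs).congr_of_eventuallyEq ?_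
    filter_upwards [eventually_ne_nhds (ne_of_gt hs)] with z hz
    simp [hz]
  · refine hm.congr' ?_
    filter_upwards [eventually_ne_atTop 0] with z hz
    simp [hz]

def erfP (z : ℝ) : ℝ := ∫ w in (0:ℝ)..z, Real.exp (-1 * w ^ 2)

theorem erfP_deriv (z : ℝ) : HasDerivAt erfP (Real.exp (-1 * z ^ 2)) z := by
  have hc : Continuous fun w : ℝ => Real.exp (-1 * w ^ 2) := by fun_prop
  exact intervalIntegral.integral_hasDerivAt_right (hc.intervalIntegrable _ _)
    (hc.stronglyMeasurableAtFilter _ _) hc.continuousAt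

theorem erfP_top : Tendsto erfP atTop (𝓝 (√π / 2)) := by
  have h := intervalIntegral_tendsto_integral_Ioi (μ := volume) (l := atTop) (b := fun z : ℝ => z)
    (f := fun w : ℝ => Real.exp (-1 * w ^ 2)) 0
    (integrable_exp_neg_mul_sq (by norm_num)).integrableOn tendsto_id
  rw [integral_gaussian_Ioi, div_one] at h
  exact h

theorem erfP_neg (z : ℝ) : erfP (-z) = - erfP z := by
  have := intervalIntegral.integral_comp_neg (a := 0) (b := z) (fun w : ℝ => Real.exp (-1 * w ^ 2))
  unfold erfP
  rw [intervalIntegral.integral_symm]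
  simp only [neg_sq, neg_zero] at this
  rw [this]

theorem erfP_bot : Tendsto erfP atBot (𝓝 (-(√π / 2))) := by
  have := (erfP_top.comp tendsto_neg_atBot_atTop).neg
  refine this.congr fun z => ?_
  simp [erfP_neg]

theorem erfP_zero : erfP 0 = 0 := by simp [erfP]

theorem aux_A_nonneg (r y : ℝ) (hr : 0 < r) (hy : 0 ≤ y) :
    ∫ s in Set.Ioi (0:ℝ), Real.exp (-s * r ^ 2) * Gv s y = (2 * r)⁻¹ * Real.exp (-r * y) := by
  set F : ℝ → ℝ := fun s => (2 * r * √π)⁻¹ * (Real.exp (-r * y) * erfP (r * √s - y / 2 * (√s)⁻¹)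
    + Real.exp (r * y) * erfP (r * √s + y / 2 * (√s)⁻¹)) with hF
  have hpi : 0 < √π := Real.sqrt_pos.2 Real.pi_pos
  have hd : ∀ s ∈ Set.Ioi (0:ℝ), HasDerivAt F (Real.exp (-s * r ^ 2) * Gv s y) s := by
    intro s hs
    have hs' : 0 < √s := Real.sqrt_pos.2 hs
    have hsq : √s ^ 2 = s := Real.sq_sqrt (le_of_lt hs)
    have h1 := Real.hasDerivAt_sqrt (ne_of_gt hs)
    have h2 := h1.inv hs'.ne'
    have h3 := (erfP_deriv _).comp s ((h1.const_mul r).sub (h2.const_mul (y/2)))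
    have h4 := (erfP_deriv _).comp s ((h1.const_mul r).add (h2.const_mul (y/2)))
    have h5 := ((h3.const_mul (Real.exp (-r * y))).add
      (h4.const_mul (Real.exp (r * y)))).const_mul ((2 * r * √π)⁻¹)
    refine h5.congr_deriv ?_
    have e1 : Real.exp (-r * y) * Real.exp (-1 * (r * √s - y / 2 * (√s)⁻¹) ^ 2)
        = Real.exp (-s * r ^ 2) * Real.exp (-(y ^ 2) / (4 * s)) := by
      rw [← Real.exp_add, ← Real.exp_add]
      congr 1
      have e0 : -s * r ^ 2 + -(y ^ 2) / (4 * s)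
          = -√s ^ 2 * r ^ 2 + -(y ^ 2) / (4 * √s ^ 2) := by rw [hsq]
      rw [e0]; field_simp; ring
    have e2 : Real.exp (r * y) * Real.exp (-1 * (r * √s + y / 2 * (√s)⁻¹) ^ 2)
        = Real.exp (-s * r ^ 2) * Real.exp (-(y ^ 2) / (4 * s)) := by
      rw [← Real.exp_add, ← Real.exp_add]
      congr 1
      have e0 : -s * r ^ 2 + -(y ^ 2) / (4 * s)
          = -√s ^ 2 * r ^ 2 + -(y ^ 2) / (4 * √s ^ 2) := by rw [hsq]
      rw [e0]; field_simp; ring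
    have e3 : √(4 * π * s) = 2 * √π * √s := by
      rw [Real.sqrt_mul (by positivity), Real.sqrt_mul (by norm_num)]
      congr 2
      rw [show (4:ℝ) = 2 ^ 2 by norm_num]; exact Real.sqrt_sq (by norm_num)
    simp only [Pi.sub_apply, Pi.add_apply, ← mul_assoc, e1, e2, Gv, e3,
      Pi.inv_apply]
    set E := Real.exp (-s * r ^ 2) * Real.exp (-(y ^ 2) / (4 * s))
    rw [show Real.exp (-s * r ^ 2) * (2 * √π * √s)⁻¹ * Real.exp (-(y ^ 2) / (4 * s))
      = E * (2 * √π * √s)⁻¹ by simp only [E]; ring]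
    generalize E = E'
    field_simp
    ring
  have hp : ∀ s ∈ Set.Ioi (0:ℝ), 0 ≤ Real.exp (-s * r ^ 2) * Gv s y := by
    intro s hs; unfold Gv; positivity
  have hinv : Tendsto (fun s : ℝ => y / 2 * (√s)⁻¹) atTop (𝓝 0) := by
    simpa using (tendsto_inv_atTop_zero.comp Real.tendsto_sqrt_atTop).const_mul (y/2)
  have hrs : Tendsto (fun s : ℝ => r * √s) atTop atTop :=
    Real.tendsto_sqrt_atTop.const_mul_atTop hr
  have hm : Tendsto F atTop (𝓝 ((2 * r * √π)⁻¹ * (Real.exp (-r * y) * (√π / 2)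
    + Real.exp (r * y) * (√π / 2)))) := by
    refine Tendsto.const_mul _ (Tendsto.add (Tendsto.const_mul _ ?_) (Tendsto.const_mul _ ?_))
    · refine erfP_top.comp ?_
      simpa [sub_eq_add_neg] using hrs.atTop_add hinv.neg
    · exact erfP_top.comp (hrs.atTop_add hinv)
  have hs0 : Tendsto (fun s : ℝ => √s) (𝓝[>] 0) (𝓝[>] 0) := by
    refine tendsto_nhdsWithin_iff.2 ⟨?_, ?_⟩
    · have := (Real.continuous_sqrt.tendsto 0).mono_left (nhdsWithin_le_nhds (s := Set.Ioi 0))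
      simpa using this
    · filter_upwards [self_mem_nhdsWithin] with s hs using Real.sqrt_pos.2 hs
  have hrs0 : Tendsto (fun s : ℝ => r * √s) (𝓝[>] 0) (𝓝 0) := by
    simpa using (tendsto_nhdsWithin_iff.1 hs0).1.const_mul r
  rcases hy.eq_or_lt with rfl | hy
  · have h0 : Tendsto F (𝓝[>] 0) (𝓝 0) := by
      have h := (erfP_deriv 0).continuousAt.tendsto.comp hrs0
      rw [erfP_zero] at h
      have := (h.add h).const_mul ((2 * r * √π)⁻¹)
      simpa [hF, Function.comp_def] using this
    rw [aux_ftc F _ _ _ h0 hd hp hm]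
    simp
    field_simp
  · have hi0 : Tendsto (fun s : ℝ => y / 2 * (√s)⁻¹) (𝓝[>] 0) atTop :=
      (tendsto_inv_nhdsGT_zero.comp hs0).const_mul_atTop (by positivity)
    have h0 : Tendsto F (𝓝[>] 0) (𝓝 ((2 * r * √π)⁻¹ * (Real.exp (-r * y) * (-(√π / 2))
      + Real.exp (r * y) * (√π / 2)))) := by
      refine Tendsto.const_mul _ (Tendsto.add (Tendsto.const_mul _ ?_) (Tendsto.const_mul _ ?_))
      · refine erfP_bot.comp ?_
        simpa [sub_eq_add_neg] using hrs0.add_atBot (tendsto_neg_atTop_atBot.comp hi0)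
      · exact erfP_top.comp (hrs0.add_atTop hi0)
    rw [aux_ftc F _ _ _ h0 hd hp hm]
    field_simp
    ring

theorem aux_A (r y : ℝ) (hr : 0 < r) :
    ∫ s in Set.Ioi (0:ℝ), Real.exp (-s * r ^ 2) * Gv s y = (2 * r)⁻¹ * Real.exp (-r * |y|) := by
  rw [← aux_A_nonneg r |y| hr (abs_nonneg y)]
  simp [Gv]

theorem aux_int (t : ℝ) (ht : 0 < t) :
    IntegrableOn (fun s : ℝ => (t + s)⁻¹ * (√s)⁻¹) (Set.Ioi 0) := by
  have hmeas : Measurable fun s : ℝ => (t + s)⁻¹ * (√s)⁻¹ := by fun_prop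
  rw [← Set.Ioc_union_Ioi_eq_Ioi (zero_le_one' ℝ)]
  refine IntegrableOn.union ?_ ?_
  · have h := (intervalIntegral.intervalIntegrable_rpow' (a := 0) (b := 1)
      (r := -(1/2 : ℝ)) (by norm_num)).1.const_mul t⁻¹
    refine Integrable.mono' h hmeas.aestronglyMeasurable ?_
    refine (ae_restrict_iff' measurableSet_Ioc).2 (Eventually.of_forall fun s hs => ?_)
    have hs0 : 0 < s := hs.1
    rw [Real.norm_of_nonneg (by positivity), Real.rpow_neg hs0.le, ← Real.sqrt_eq_rpow]
    gcongr
    linarith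
  · have h := integrableOn_Ioi_rpow_of_lt (a := -(3/2 : ℝ)) (c := 1) (by norm_num) one_pos
    refine Integrable.mono' h hmeas.aestronglyMeasurable ?_
    refine (ae_restrict_iff' measurableSet_Ioi).2 (Eventually.of_forall fun s hs => ?_)
    have hs0 : 0 < s := lt_trans one_pos hs
    rw [Real.norm_of_nonneg (by positivity), Real.rpow_neg hs0.le,
      show (3/2 : ℝ) = 1 + 1/2 by norm_num, Real.rpow_add hs0, ← Real.sqrt_eq_rpow,
      Real.rpow_one, mul_inv]
    gcongr
    linarith

def gk (b a ξ : ℝ) : ℂ := Complex.exp (Complex.I * a * ξ) * Complex.exp (-(b : ℂ) * ξ ^ 2)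

theorem gk_norm (b a ξ : ℝ) : ‖gk b a ξ‖ = Real.exp (-b * ξ ^ 2) := by
  rw [gk, ← Complex.exp_add, Complex.norm_exp]
  congr 1
  simp [← Complex.ofReal_pow]

theorem gk_meas : Measurable fun p : ℝ × ℝ × ℝ => gk p.1 p.2.1 p.2.2 := by
  unfold gk; fun_prop

theorem gk_integrable (b a : ℝ) (hb : 0 < b) : Integrable (gk b a) := by
  refine Integrable.mono' (integrable_exp_neg_mul_sq hb) ?_ (Eventually.of_forall fun ξ => ?_)
  · exact (by unfold gk; fun_prop : Continuous (gk b a)).aestronglyMeasurable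
  · rw [gk_norm]

theorem gk_integral (b a : ℝ) (hb : 0 < b) :
    ∫ ξ, gk b a ξ = ((√(π / b) * Real.exp (-(a ^ 2) / (4 * b)) : ℝ) : ℂ) := by
  unfold gk
  rw [fourierIntegral_gaussian (by simpa using hb)]
  rw [Real.sqrt_eq_rpow]
  push_cast
  rw [Complex.ofReal_cpow (by positivity)]
  push_cast
  rfl

theorem gk_norm_integral (b a : ℝ) : ∫ ξ, ‖gk b a ξ‖ = √(π / b) := by
  simp only [gk_norm]
  exact integral_gaussian b

/-- three-dimensional integrand -/
def f3 (t : ℝ) (x : V3) (s : ℝ) (ξ : V3) : ℂ :=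
  gk (t + s) x.1.1 ξ.1.1 * gk (t + s) x.1.2 ξ.1.2 * gk s x.2 ξ.2

/-- two-dimensional integrand -/
def f2 (t : ℝ) (x : V3) (s : ℝ) (ξ : ℝ × ℝ) : ℂ :=
  gk (t + s) x.1.1 ξ.1 * gk (t + s) x.1.2 ξ.2 * (Gv s x.2 : ℂ)

theorem gk2_int (b a a' : ℝ) (hb : 0 < b) :
    Integrable (fun ξ : ℝ × ℝ => gk b a ξ.1 * gk b a' ξ.2) :=
  (gk_integrable b a hb).mul_prod (gk_integrable b a' hb)

theorem sqrt_pi_div (s : ℝ) : √(π / s) = √π * (√s)⁻¹ := by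
  rw [Real.sqrt_div Real.pi_pos.le]; rfl

theorem f3_int (t : ℝ) (ht : 0 < t) (x : V3) :
    Integrable (Function.uncurry (f3 t x))
      ((volume.restrict (Set.Ioi (0:ℝ))).prod (volume : Measure V3)) := by
  rw [integrable_prod_iff]
  · constructor
    · refine (ae_restrict_iff' measurableSet_Ioi).2 (Eventually.of_forall fun s hs => ?_)
      have hs0 : 0 < s := hs
      exact (gk2_int (t+s) x.1.1 x.1.2 (by positivity)).mul_prod (gk_integrable s x.2 hs)
    · refine Integrable.congr (f := fun s : ℝ => (π * √π) * ((t + s)⁻¹ * (√s)⁻¹))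
        ((aux_int t ht).const_mul _) ?_
      refine (ae_restrict_iff' measurableSet_Ioi).2 (Eventually.of_forall fun s hs => ?_)
      have hs0 : 0 < s := hs
      simp only [Function.uncurry, f3, norm_mul]
      have h1 := integral_prod_mul (μ := (volume : Measure (ℝ × ℝ))) (ν := (volume : Measure ℝ))
        (fun ξ : ℝ × ℝ => ‖gk (t+s) x.1.1 ξ.1‖ * ‖gk (t+s) x.1.2 ξ.2‖) (fun z => ‖gk s x.2 z‖)
      have h2 := integral_prod_mul (μ := (volume : Measure ℝ)) (ν := (volume : Measure ℝ))
        (fun z : ℝ => ‖gk (t+s) x.1.1 z‖) (fun z => ‖gk (t+s) x.1.2 z‖)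
      rw [Measure.volume_eq_prod (ℝ × ℝ) ℝ, h1, Measure.volume_eq_prod ℝ ℝ, h2,
        gk_norm_integral, gk_norm_integral, gk_norm_integral,
        Real.mul_self_sqrt (by positivity), sqrt_pi_div]
      ring
  · refine Measurable.aestronglyMeasurable ?_
    unfold f3 gk Function.uncurry
    fun_prop

theorem f2_int (t : ℝ) (ht : 0 < t) (x : V3) :
    Integrable (Function.uncurry (f2 t x))
      ((volume.restrict (Set.Ioi (0:ℝ))).prod (volume : Measure (ℝ × ℝ))) := by
  have hm : Measurable (Function.uncurry (f2 t x)) := by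
    unfold f2 gk Gv Function.uncurry
    fun_prop
  rw [integrable_prod_iff hm.aestronglyMeasurable]
  constructor
  · refine (ae_restrict_iff' measurableSet_Ioi).2 (Eventually.of_forall fun s hs => ?_)
    have hs0 : 0 < s := hs
    exact (gk2_int (t+s) x.1.1 x.1.2 (by positivity)).mul_const (Gv s x.2 : ℂ)
  · refine Integrable.mono' (g := fun s : ℝ => (π * (√(4 * π))⁻¹) * ((t + s)⁻¹ * (√s)⁻¹))
      ((aux_int t ht).const_mul _)
      hm.stronglyMeasurable.norm.integral_prod_right.aestronglyMeasurable ?_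
    refine (ae_restrict_iff' measurableSet_Ioi).2 (Eventually.of_forall fun s hs => ?_)
    have hs0 : 0 < s := hs
    simp only [Function.uncurry, f2, norm_mul]
    have h2 := integral_prod_mul (μ := (volume : Measure ℝ)) (ν := (volume : Measure ℝ))
      (fun z : ℝ => ‖gk (t+s) x.1.1 z‖) (fun z => ‖gk (t+s) x.1.2 z‖)
    rw [integral_mul_const, Measure.volume_eq_prod ℝ ℝ, h2,
      gk_norm_integral, gk_norm_integral, Real.mul_self_sqrt (by positivity)]
    have hG : 0 ≤ Gv s x.2 := by unfold Gv; positivity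
    rw [Complex.norm_real, Real.norm_of_nonneg hG, Real.norm_of_nonneg (by positivity)]
    have hG2 : Gv s x.2 ≤ (√(4 * π))⁻¹ * (√s)⁻¹ := by
      unfold Gv
      rw [Real.sqrt_mul (by positivity), mul_inv]
      refine mul_le_of_le_one_right (by positivity) (Real.exp_le_one_iff.2 ?_)
      exact div_nonpos_of_nonpos_of_nonneg (by nlinarith [sq_nonneg x.2]) (by positivity)
    calc π / (t + s) * Gv s x.2 ≤ π / (t + s) * ((√(4 * π))⁻¹ * (√s)⁻¹) := by gcongr
      _ = _ := by ring

theorem f2_inner (t : ℝ) (ht : 0 < t) (x : V3) (s : ℝ) (hs : 0 < s) :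
    ∫ ξ, f2 t x s ξ = (((2 * π) ^ 2 * (Gh (t + s) x.1 * Gv s x.2) : ℝ) : ℂ) := by
  have h2 := integral_prod_mul (μ := (volume : Measure ℝ)) (ν := (volume : Measure ℝ))
    (gk (t+s) x.1.1) (gk (t+s) x.1.2)
  unfold f2
  rw [integral_mul_const, Measure.volume_eq_prod ℝ ℝ, h2, gk_integral _ _ (by positivity),
    gk_integral _ _ (by positivity), ← Complex.ofReal_mul, ← Complex.ofReal_mul, ← mul_assoc ((2 * π) ^ 2)]
  congr 2
  rw [show ∀ a b c : ℝ, a * b * (a * c) = (a * a) * (b * c) by intros; ring,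
    Real.mul_self_sqrt (by positivity), ← Real.exp_add, Gh, ← add_div, ← neg_add, ← mul_assoc]
  congr 1
  field_simp
  ring

theorem f3_inner (t : ℝ) (ht : 0 < t) (x : V3) (s : ℝ) (hs : 0 < s) :
    ∫ ξ, f3 t x s ξ = (((2 * π) ^ 3 * (Gh (t + s) x.1 * Gv s x.2) : ℝ) : ℂ) := by
  have h1 := integral_prod_mul (μ := (volume : Measure (ℝ × ℝ))) (ν := (volume : Measure ℝ))
    (fun ξ : ℝ × ℝ => gk (t+s) x.1.1 ξ.1 * gk (t+s) x.1.2 ξ.2) (gk s x.2)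
  have h2 := f2_inner t ht x s hs
  have hG : (Gv s x.2 : ℂ) ≠ 0 := by
    rw [Complex.ofReal_ne_zero]; unfold Gv; positivity
  unfold f2 at h2
  rw [integral_mul_const, ← mul_assoc, Complex.ofReal_mul _ (Gv s x.2)] at h2
  have h3 := mul_right_cancel₀ hG h2
  unfold f3
  rw [Measure.volume_eq_prod (ℝ × ℝ) ℝ, h1, h3, gk_integral _ _ hs, ← Complex.ofReal_mul]
  congr 1
  have e3 : √(π / s) = 2 * π * (√(4 * π * s))⁻¹ := by
    rw [Real.sqrt_mul (by positivity), Real.sqrt_mul (by norm_num), sqrt_pi_div,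
      show √(4:ℝ) = 2 by rw [show (4:ℝ) = 2 ^ 2 by norm_num]; exact Real.sqrt_sq (by norm_num)]
    have := Real.mul_self_sqrt Real.pi_pos.le
    have hp : 0 < √π := Real.sqrt_pos.2 Real.pi_pos
    have hp : 0 < √s := Real.sqrt_pos.2 hs
    field_simp
    linarith
  rw [e3, Gv]
  ring

theorem f3_outer (t : ℝ) (x : V3) (ξ : V3) (hξ : ξ ≠ 0) :
    ∫ s in Set.Ioi (0:ℝ), f3 t x s ξ =
      Complex.exp (Complex.I * ((x.1.1 * ξ.1.1 + x.1.2 * ξ.1.2 + x.2 * ξ.2 : ℝ) : ℂ)) *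
        ((ξ.1.1 ^ 2 + ξ.1.2 ^ 2 + ξ.2 ^ 2 : ℝ) : ℂ)⁻¹ *
        ((Real.exp (-t * (ξ.1.1 ^ 2 + ξ.1.2 ^ 2)) : ℝ) : ℂ) := by
  have hpos : 0 < ξ.1.1 ^ 2 + ξ.1.2 ^ 2 + ξ.2 ^ 2 := by
    by_contra h
    apply hξ
    have h1 : ξ.1.1 = 0 := by nlinarith [sq_nonneg ξ.1.1, sq_nonneg ξ.1.2, sq_nonneg ξ.2]
    have h2 : ξ.1.2 = 0 := by nlinarith [sq_nonneg ξ.1.1, sq_nonneg ξ.1.2, sq_nonneg ξ.2]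
    have h3 : ξ.2 = 0 := by nlinarith [sq_nonneg ξ.1.1, sq_nonneg ξ.1.2, sq_nonneg ξ.2]
    exact Prod.ext (Prod.ext h1 h2) h3
  set R := ξ.1.1 ^ 2 + ξ.1.2 ^ 2 + ξ.2 ^ 2 with hR
  have h : ∀ s : ℝ, f3 t x s ξ =
      Complex.exp (Complex.I * ((x.1.1 * ξ.1.1 + x.1.2 * ξ.1.2 + x.2 * ξ.2 : ℝ) : ℂ)) *
        ((Real.exp (-R * s) : ℝ) : ℂ) *
        ((Real.exp (-t * (ξ.1.1 ^ 2 + ξ.1.2 ^ 2)) : ℝ) : ℂ) := by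
    intro s
    simp only [f3, gk, Complex.ofReal_exp, ← Complex.exp_add, hR]
    congr 1
    push_cast
    ring
  simp only [h]
  rw [integral_mul_const, integral_const_mul, integral_complex_ofReal,
    integral_exp_mul_Ioi (by linarith)]
  congr 3
  rw [← Complex.ofReal_inv]
  congr 1
  simp

theorem f2_outer (t : ℝ) (x : V3) (ξ : ℝ × ℝ) (hξ : ξ ≠ 0) :
    ∫ s in Set.Ioi (0:ℝ), f2 t x s ξ =
      Complex.exp (Complex.I * ((x.1.1 * ξ.1 + x.1.2 * ξ.2 : ℝ) : ℂ)) *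
        ((2 * Real.sqrt (ξ.1 ^ 2 + ξ.2 ^ 2) : ℝ) : ℂ)⁻¹ *
        ((Real.exp (-t * (ξ.1 ^ 2 + ξ.2 ^ 2)) : ℝ) : ℂ) *
        ((Real.exp (-(Real.sqrt (ξ.1 ^ 2 + ξ.2 ^ 2)) * |x.2|) : ℝ) : ℂ) := by
  have hpos : 0 < ξ.1 ^ 2 + ξ.2 ^ 2 := by
    by_contra h
    apply hξ
    have h1 : ξ.1 = 0 := by nlinarith [sq_nonneg ξ.1, sq_nonneg ξ.2]
    have h2 : ξ.2 = 0 := by nlinarith [sq_nonneg ξ.1, sq_nonneg ξ.2]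
    exact Prod.ext h1 h2
  have hA := aux_A (√(ξ.1 ^ 2 + ξ.2 ^ 2)) x.2 (Real.sqrt_pos.2 hpos)
  rw [Real.sq_sqrt hpos.le] at hA
  have h : ∀ s : ℝ, f2 t x s ξ =
      Complex.exp (Complex.I * ((x.1.1 * ξ.1 + x.1.2 * ξ.2 : ℝ) : ℂ)) *
        ((Real.exp (-t * (ξ.1 ^ 2 + ξ.2 ^ 2)) : ℝ) : ℂ) *
        ((Real.exp (-s * (ξ.1 ^ 2 + ξ.2 ^ 2)) * Gv s x.2 : ℝ) : ℂ) := by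
    intro s
    simp only [f2, gk, Complex.ofReal_mul, Complex.ofReal_exp, ← mul_assoc]
    congr 1
    simp only [← Complex.exp_add]
    congr 1
    push_cast
    ring
  simp only [h]
  rw [integral_const_mul, integral_complex_ofReal, hA, Complex.ofReal_mul, Complex.ofReal_inv]
  ring

theorem ae_ne2 : ∀ᵐ ξ : ℝ × ℝ, ξ ≠ 0 := by
  have h : (volume : Measure (ℝ × ℝ)) {0} = 0 := by
    rw [show ({0} : Set (ℝ × ℝ)) = {0} ×ˢ {0} by rw [Set.singleton_prod_singleton]; rfl,
      Measure.volume_eq_prod, Measure.prod_prod]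
    simp
  exact compl_mem_ae_iff.2 h

theorem ae_ne3 : ∀ᵐ ξ : V3, ξ ≠ 0 := by
  have h : (volume : Measure V3) {0} = 0 := by
    rw [show ({0} : Set V3) = {0} ×ˢ {0} by rw [Set.singleton_prod_singleton]; rfl,
      Measure.volume_eq_prod, Measure.prod_prod]
    simp
  exact compl_mem_ae_iff.2 h

/-- explicit formula for the kernel K. -/
theorem kernel_formula (t : ℝ) (ht : 0 < t) (x : V3) :
    Integrable (fun ξ : (ℝ × ℝ) × ℝ =>
      Complex.exp (Complex.I * ((x.1.1 * ξ.1.1 + x.1.2 * ξ.1.2 + x.2 * ξ.2 : ℝ) : ℂ)) *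
        ((ξ.1.1 ^ 2 + ξ.1.2 ^ 2 + ξ.2 ^ 2 : ℝ) : ℂ)⁻¹ *
        ((Real.exp (-t * (ξ.1.1 ^ 2 + ξ.1.2 ^ 2)) : ℝ) : ℂ)) (volume : Measure V3) ∧
    Integrable (fun ξh : ℝ × ℝ =>
      Complex.exp (Complex.I * ((x.1.1 * ξh.1 + x.1.2 * ξh.2 : ℝ) : ℂ)) *
        ((2 * Real.sqrt (ξh.1 ^ 2 + ξh.2 ^ 2) : ℝ) : ℂ)⁻¹ *
        ((Real.exp (-t * (ξh.1 ^ 2 + ξh.2 ^ 2)) : ℝ) : ℂ) *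
        ((Real.exp (-(Real.sqrt (ξh.1 ^ 2 + ξh.2 ^ 2)) * |x.2|) : ℝ) : ℂ))
      (volume : Measure (ℝ × ℝ)) ∧
    ((((2 * π) ^ 3)⁻¹ : ℝ) : ℂ) *
      (∫ ξ : (ℝ × ℝ) × ℝ,
        Complex.exp (Complex.I * ((x.1.1 * ξ.1.1 + x.1.2 * ξ.1.2 + x.2 * ξ.2 : ℝ) : ℂ)) *
          ((ξ.1.1 ^ 2 + ξ.1.2 ^ 2 + ξ.2 ^ 2 : ℝ) : ℂ)⁻¹ *
          ((Real.exp (-t * (ξ.1.1 ^ 2 + ξ.1.2 ^ 2)) : ℝ) : ℂ)) = ((Kker t x : ℝ) : ℂ) ∧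
    ((((2 * π) ^ 2)⁻¹ : ℝ) : ℂ) *
      (∫ ξh : ℝ × ℝ,
        Complex.exp (Complex.I * ((x.1.1 * ξh.1 + x.1.2 * ξh.2 : ℝ) : ℂ)) *
          ((2 * Real.sqrt (ξh.1 ^ 2 + ξh.2 ^ 2) : ℝ) : ℂ)⁻¹ *
          ((Real.exp (-t * (ξh.1 ^ 2 + ξh.2 ^ 2)) : ℝ) : ℂ) *
          ((Real.exp (-(Real.sqrt (ξh.1 ^ 2 + ξh.2 ^ 2)) * |x.2|) : ℝ) : ℂ)) =
      ((Kker t x : ℝ) : ℂ) := by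
  have i3 := ae_ne3.mono (f3_outer t x)
  have i2 := ae_ne2.mono (f2_outer t x)
  refine ⟨(f3_int t ht x).integral_prod_right.congr i3,
    (f2_int t ht x).integral_prod_right.congr i2, ?_, ?_⟩
  · rw [← integral_congr_ae i3, ← integral_integral_swap (f3_int t ht x),
      setIntegral_congr_fun measurableSet_Ioi (fun s hs => f3_inner t ht x s hs),
      integral_complex_ofReal, integral_const_mul, ← Complex.ofReal_mul, ← mul_assoc,
      inv_mul_cancel₀ (by positivity), one_mul, Kker]
  · rw [← integral_congr_ae i2, ← integral_integral_swap (f2_int t ht x),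
      setIntegral_congr_fun measurableSet_Ioi (fun s hs => f2_inner t ht x s hs),
      integral_complex_ofReal, integral_const_mul, ← Complex.ofReal_mul, ← mul_assoc,
      inv_mul_cancel₀ (by positivity), one_mul, Kker]

end
end

section
/- Let 1 ≤ p,q ≤ ∞, let β ∈ (ℕ∪{0})² be a horizontal multi-index, let γ ∈ ℕ∪{0} and m ∈ ℕ∪{0} satisfy |β|+γ > 2/p + 1/q − 1 + m. Then there exists a constant C = C(p,q,β,γ,m) > 0 such that ‖ |x_h|^m·∇_h^β(−Δ_h)^{γ/2}K(t,x) ‖_{L_h^pL_v^q} ≤ C·t^{−(1−1/p)−(1/2)(1−1/q)−(|β|+γ−2)/2+m/2} for all t > 0. Moreover, if 1 ≤ p₁,p₂ ≤ p and 1 ≤ q₁,q₂ ≤ q satisfy (1/p₁−1/p)+(1/2)(1/q₁−1/q)+(|β|+γ−3)/2 > 0 and (1/p₂−1/p)+(1/2)(1/q₂−1/q)+(|β|+γ−2)/2 > 0, then there exists C = C(p,p₁,p₂,q,q₁,q₂,β,γ) > 0 such that ‖ |x_h|·(∇_h^β(−Δ_h)^{γ/2}K(t) * f)(x) ‖_{L_h^pL_v^q}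 ≤ C·t^{−(1/p₁−1/p)−(1/2)(1/q₁−1/q)−(|β|+γ−3)/2}·‖f‖_{L_h^{p₁}L_v^{q₁}} + C·t^{−(1/p₂−1/p)−(1/2)(1/q₂−1/q)−(|β|+γ−2)/2}·‖ |x_h|f(x) ‖_{L_h^{p₂}L_v^{q₂}} for all t > 0 and all functions f with f ∈ L_h^{p₁}L_v^{q₁}(ℝ³) and |x_h|f(x) ∈ L_h^{p₂}L_v^{q₂}(ℝ³), where * denotes convolution on ℝ³. -/
open MeasureTheory Real Filter Topology
open scoped ENNReal

noncomputable section

section lpnlem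
variable {α β : Type*} [MeasurableSpace α] [MeasurableSpace β]

lemma lpn_mono_ae {p : ℝ≥0∞} {μ : Measure α} {f g : α → ℝ≥0∞} (h : f ≤ᵐ[μ] g) :
    lpn p μ f ≤ lpn p μ g := by
  unfold lpn
  split_ifs
  · exact essSup_mono_ae h
  · refine ENNReal.rpow_le_rpow (lintegral_mono_ae ?_) (by positivity)
    filter_upwards [h] with a ha
    exact ENNReal.rpow_le_rpow ha ENNReal.toReal_nonneg

lemma lpn_mono {p : ℝ≥0∞} {μ : Measure α} {f g : α → ℝ≥0∞} (h : ∀ x, f x ≤ g x) :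
    lpn p μ f ≤ lpn p μ g := lpn_mono_ae (Eventually.of_forall h)

lemma lpn_eq_eLpNorm {p : ℝ≥0∞} (hp : 1 ≤ p) {μ : Measure α} (f : α → ℝ≥0∞) :
    lpn p μ f = eLpNorm f p μ := by
  unfold lpn
  have hp0 : p ≠ 0 := (lt_of_lt_of_le one_pos hp).ne'
  split_ifs with h
  · subst h; simp [eLpNorm_exponent_top, eLpNormEssSup]
  · rw [eLpNorm_eq_lintegral_rpow_enorm_toReal hp0 h]; simp

lemma lpn_add_le {p : ℝ≥0∞} (hp : 1 ≤ p) {μ : Measure α} {f g : α → ℝ≥0∞}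
    (hf : Measurable f) (hg : Measurable g) :
    lpn p μ (fun x => f x + g x) ≤ lpn p μ f + lpn p μ g := by
  rw [lpn_eq_eLpNorm hp, lpn_eq_eLpNorm hp, lpn_eq_eLpNorm hp]
  exact eLpNorm_add_le hf.aestronglyMeasurable hg.aestronglyMeasurable hp

lemma lpn_const_mul {p : ℝ≥0∞} (hp : 1 ≤ p) {μ : Measure α} (c : ℝ≥0∞) {f : α → ℝ≥0∞}
    (hf : Measurable f) :
    lpn p μ (fun x => c * f x) = c * lpn p μ f := by
  unfold lpn
  split_ifs with h
  · exact ENNReal.essSup_const_mul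
  · have hp0 : 0 < p.toReal := ENNReal.toReal_pos (lt_of_lt_of_le one_pos hp).ne' h
    simp_rw [ENNReal.mul_rpow_of_nonneg _ _ hp0.le]
    rw [lintegral_const_mul _ (hf.pow_const _), ENNReal.mul_rpow_of_nonneg _ _ (by positivity),
      ← ENNReal.rpow_mul, mul_one_div_cancel hp0.ne', ENNReal.rpow_one]

lemma le_lpn_top {μ : Measure α} (f : α → ℝ≥0∞) : ∀ᵐ x ∂μ, f x ≤ lpn ∞ μ f := by
  simp only [lpn, if_true]; exact ENNReal.ae_le_essSup f

lemma lpn_top_le {μ : Measure α} {f : α → ℝ≥0∞} {c : ℝ≥0∞} (h : ∀ᵐ x ∂μ, f x ≤ c) :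
    lpn ∞ μ f ≤ c := by
  simp only [lpn, if_true]; exact essSup_le_of_ae_le c h

lemma measurable_lpn {p : ℝ≥0∞} {ν : Measure β} [SFinite ν] {f : α × β → ℝ≥0∞}
    (hf : Measurable f) : Measurable (fun x => lpn p ν (fun y => f (x, y))) := by
  by_cases h : p = ∞
  · subst h
    apply measurable_of_Iic
    intro c
    have : (fun x => lpn ∞ ν (fun y => f (x, y))) ⁻¹' Set.Iic c =
        (fun x => ν (Prod.mk x ⁻¹' (f ⁻¹' Set.Ioi c))) ⁻¹' {0} := by
      ext x
      simp only [Set.mem_preimage, Set.mem_Iic, Set.mem_singleton_iff]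
      constructor
      · intro hx
        have := le_lpn_top (μ := ν) (fun y => f (x, y))
        have h2 : ∀ᵐ y ∂ν, f (x, y) ≤ c := this.mono fun y hy => hy.trans hx
        rw [ae_iff] at h2
        convert h2 using 2
        ext y; simp
      · intro hx
        apply lpn_top_le
        rw [ae_iff]
        convert hx using 2
        ext y; simp
    rw [this]
    exact measurable_measure_prodMk_left (hf measurableSet_Ioi) (measurableSet_singleton 0)
  · unfold lpn
    simp only [h, if_false]
    exact (Measurable.lintegral_prod_right' (f := fun z : α × β => f z ^ p.toReal)
      (hf.pow_const _)).pow_const _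

/-- Key step: truncated Minkowski. -/
lemma mink_aux {μ : Measure α} [SFinite μ] {ν : Measure β} [SFinite ν] {q : ℝ} (hq : 1 ≤ q)
    {F : α × β → ℝ≥0∞} (hF : Measurable F) {T : α → ℝ≥0∞} (hT : Measurable T)
    (hTS : ∀ x, T x ≤ ∫⁻ y, F (x, y) ∂ν) (hfin : ∫⁻ x, T x ^ q ∂μ ≠ ∞) :
    (∫⁻ x, T x ^ q ∂μ) ^ (1 / q) ≤ ∫⁻ y, (∫⁻ x, F (x, y) ^ q ∂μ) ^ (1 / q) ∂ν := by
  have hq0 : 0 < q := by linarith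
  set I := ∫⁻ x, T x ^ q ∂μ with hI
  by_cases hI0 : I = 0
  · rw [hI0, ENNReal.zero_rpow_of_pos (by positivity)]; exact zero_le
  have h1 : I ≤ ∫⁻ y, (∫⁻ x, T x ^ (q - 1) * F (x, y) ∂μ) ∂ν := by
    rw [lintegral_lintegral_swap (f := fun y x => T x ^ (q - 1) * F (x, y))]
    · refine lintegral_mono fun x => ?_
      rw [lintegral_const_mul _ (show Measurable fun y => F (x, y) from hF.comp measurable_prodMk_left)]
      calc T x ^ q = T x ^ (q - 1) * T x := by
            conv_rhs => rw [← ENNReal.rpow_one (T x), ← ENNReal.rpow_mul, one_mul]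
            rw [← ENNReal.rpow_add_of_nonneg _ _ (by linarith) (by norm_num)]; congr 1; ring
        _ ≤ _ := by gcongr; exact hTS x
    · exact (((hT.comp measurable_snd).pow_const _).mul (hF.comp measurable_swap)).aemeasurable
  have h2 : ∀ y, (∫⁻ x, T x ^ (q - 1) * F (x, y) ∂μ) ≤
      I ^ (1 - 1 / q) * (∫⁻ x, F (x, y) ^ q ∂μ) ^ (1 / q) := by
    intro y
    have := ENNReal.lintegral_mul_norm_pow_le (μ := μ) (f := fun x => T x ^ q)
      (g := fun x => F (x, y) ^ q) (hT.pow_const _).aemeasurable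
      ((hF.comp measurable_prodMk_right).pow_const _).aemeasurable (p := 1 - 1/q) (q := 1/q)
      (by rw [sub_nonneg, div_le_one hq0]; exact hq) (by positivity) (by ring)
    refine le_trans (lintegral_mono fun x => ?_) this
    rw [← ENNReal.rpow_mul, ← ENNReal.rpow_mul, mul_one_div_cancel hq0.ne', ENNReal.rpow_one,
      mul_sub, mul_one_div_cancel hq0.ne', mul_one]
  have h3 : I ≤ I ^ (1 - 1 / q) * ∫⁻ y, (∫⁻ x, F (x, y) ^ q ∂μ) ^ (1 / q) ∂ν := by
    refine h1.trans ((lintegral_mono h2).trans_eq ?_)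
    rw [lintegral_const_mul]
    exact (Measurable.lintegral_prod_left' (f := fun z : α × β => F z ^ q)
      (hF.pow_const _)).pow_const _
  have h4 : I = I ^ (1 - 1 / q) * I ^ (1 / q) := by
    rw [← ENNReal.rpow_add _ _ hI0 hfin]; simp
  have hne0 : I ^ (1 - 1 / q) ≠ 0 := by
    simp [ENNReal.rpow_eq_zero_iff, hI0, hfin]
  have hnet : I ^ (1 - 1 / q) ≠ ∞ := by
    simp [ENNReal.rpow_eq_top_iff, hI0, hfin]
  rw [h4] at h3
  nth_rewrite 2 [← h4] at h3
  exact (ENNReal.mul_le_mul_iff_right hne0 hnet).1 h3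

lemma minkowski {μ : Measure α} [SigmaFinite μ] {ν : Measure β} [SFinite ν] {p : ℝ≥0∞}
    (hp : 1 ≤ p) {F : α × β → ℝ≥0∞} (hF : Measurable F) :
    lpn p μ (fun x => ∫⁻ y, F (x, y) ∂ν) ≤ ∫⁻ y, lpn p μ (fun x => F (x, y)) ∂ν := by
  by_cases h : p = ∞
  · subst h
    apply lpn_top_le
    have hm : Measurable fun y => lpn ∞ μ (fun x => F (x, y)) :=
      measurable_lpn (f := fun z : β × α => F z.swap) (hF.comp measurable_swap)
    have h1 : ∀ᵐ y ∂ν, ∀ᵐ x ∂μ, F (x, y) ≤ lpn ∞ μ (fun x => F (x, y)) :=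
      Eventually.of_forall fun y => le_lpn_top _
    have hms : MeasurableSet {z : β × α | F (z.2, z.1) ≤ lpn ∞ μ (fun x => F (x, z.1))} :=
      measurableSet_le (hF.comp measurable_swap) (hm.comp measurable_fst)
    have h2 := (Measure.ae_ae_comm (p := fun y x => F (x, y) ≤ lpn ∞ μ (fun x => F (x, y)))
      (μ := ν) (ν := μ) hms).1 h1
    filter_upwards [h2] with x hx
    exact lintegral_mono_ae hx
  · unfold lpn
    simp only [h, if_false]
    have hq : 1 ≤ p.toReal := by
      rw [← ENNReal.toReal_one]; exact ENNReal.toReal_mono h hp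
    set q := p.toReal
    have hq0 : 0 < q := by linarith
    set S : α → ℝ≥0∞ := fun x => ∫⁻ y, F (x, y) ∂ν
    have hS : Measurable S := Measurable.lintegral_prod_right' hF
    set T : ℕ → α → ℝ≥0∞ := fun n => (spanningSets μ n).indicator (fun x => min (S x) n)
    have hT : ∀ n, Measurable (T n) := fun n =>
      (hS.min measurable_const).indicator (measurableSet_spanningSets μ n)
    have hTm : Monotone T := by
      intro m n hmn x
      simp only [T]
      refine Set.indicator_le_indicator_of_subset (monotone_spanningSets μ hmn) ?_ x |>.trans
        (Set.indicator_le_indicator ?_)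
      · intro; exact zero_le
      · gcongr
    have hTsup : ∀ x, ⨆ n, T n x = S x := by
      intro x
      apply le_antisymm
      · refine iSup_le fun n => ?_
        refine (Set.indicator_le_self' (fun _ _ => zero_le) x).trans (min_le_left _ _)
      · apply le_of_forall_lt
        intro c hc
        have hcn : c ≠ ∞ := ne_top_of_lt hc
        obtain ⟨n, hn⟩ := ENNReal.exists_nat_gt hcn
        have hx : x ∈ ⋃ i, spanningSets μ i := by rw [iUnion_spanningSets]; trivial
        obtain ⟨k, hk⟩ := Set.mem_iUnion.1 hx
        refine lt_of_lt_of_le ?_ (le_iSup (fun n => T n x) (max n k))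
        simp only [T]
        rw [Set.indicator_of_mem (monotone_spanningSets μ (le_max_right n k) hk)]
        refine lt_min hc (hn.trans_le ?_)
        exact_mod_cast le_max_left n k
    have hfin : ∀ n, ∫⁻ x, T n x ^ q ∂μ ≠ ∞ := by
      intro n
      have : ∫⁻ x, T n x ^ q ∂μ ≤ ∫⁻ x, (spanningSets μ n).indicator (fun _ => (n : ℝ≥0∞) ^ q) x ∂μ := by
        refine lintegral_mono fun x => ?_
        simp only [T]
        by_cases hx : x ∈ spanningSets μ n
        · rw [Set.indicator_of_mem hx, Set.indicator_of_mem hx]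
          exact ENNReal.rpow_le_rpow (min_le_right _ _) hq0.le
        · rw [Set.indicator_of_notMem hx, Set.indicator_of_notMem hx,
            ENNReal.zero_rpow_of_pos hq0]
      refine ne_top_of_le_ne_top ?_ this
      rw [lintegral_indicator (measurableSet_spanningSets μ n)]
      simp only [lintegral_const, Measure.restrict_apply_univ]
      exact ENNReal.mul_ne_top (ENNReal.rpow_ne_top_of_nonneg hq0.le (by simp))
        (measure_spanningSets_lt_top μ n).ne
    have key : ∀ n, ∫⁻ x, T n x ^ q ∂μ ≤
        (∫⁻ y, (∫⁻ x, F (x, y) ^ q ∂μ) ^ (1 / q) ∂ν) ^ q := by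
      intro n
      have := mink_aux (μ := μ) (ν := ν) hq hF (hT n)
        (fun x => (le_iSup (fun n => T n x) n).trans_eq (hTsup x)) (hfin n)
      have h2 := ENNReal.rpow_le_rpow this hq0.le
      rwa [← ENNReal.rpow_mul, one_div_mul_cancel hq0.ne', ENNReal.rpow_one] at h2
    have hlim : ∫⁻ x, S x ^ q ∂μ = ⨆ n, ∫⁻ x, T n x ^ q ∂μ := by
      rw [← lintegral_iSup (fun n => (hT n).pow_const q)]
      · refine lintegral_congr fun x => ?_
        rw [← hTsup x]
        exact (ENNReal.orderIsoRpow q hq0).map_iSup _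
      · intro m n hmn x
        exact ENNReal.rpow_le_rpow (hTm hmn x) hq0.le
    have : ∫⁻ x, S x ^ q ∂μ ≤ (∫⁻ y, (∫⁻ x, F (x, y) ^ q ∂μ) ^ (1 / q) ∂ν) ^ q := by
      rw [hlim]; exact iSup_le key
    have h3 := ENNReal.rpow_le_rpow this (z := 1/q) (by positivity)
    rwa [← ENNReal.rpow_mul, mul_one_div_cancel hq0.ne', ENNReal.rpow_one] at h3

end lpnlem


section young
variable {G : Type*} [MeasurableSpace G] [AddCommGroup G] [MeasurableAdd₂ G] [MeasurableNeg G]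

lemma lpn_inv_toReal_one {p : ℝ≥0∞} (hp : 1 ≤ p) : 0 ≤ p.toReal⁻¹ ∧ p.toReal⁻¹ ≤ 1 := by
  refine ⟨by positivity, ?_⟩
  by_cases h : p = ∞
  · simp [h]
  · apply inv_le_one_of_one_le₀
    rw [← ENNReal.toReal_one]; exact ENNReal.toReal_mono h hp

lemma toReal_inv_eq_zero {p : ℝ≥0∞} (hp : 1 ≤ p) (h : p.toReal⁻¹ = 0) : p = ∞ := by
  rw [inv_eq_zero, ENNReal.toReal_eq_zero_iff] at h
  rcases h with h | h
  · simp [h] at hp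
  · exact h

lemma toReal_inv_eq_one {p : ℝ≥0∞} (h : p.toReal⁻¹ = 1) : p = 1 := by
  rw [inv_eq_one] at h
  exact (ENNReal.toReal_eq_one_iff p).1 h

lemma lpn_one {α : Type*} [MeasurableSpace α] {μ : Measure α} (f : α → ℝ≥0∞) :
    lpn 1 μ f = ∫⁻ x, f x ∂μ := by
  simp [lpn]

lemma young {μ : Measure G} [SFinite μ] [μ.IsAddLeftInvariant] [μ.IsNegInvariant]
    {r s p : ℝ≥0∞} (hr : 1 ≤ r) (hs : 1 ≤ s) (hp : 1 ≤ p)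
    (hrsp : 1 + r.toReal⁻¹ = s.toReal⁻¹ + p.toReal⁻¹)
    {k g : G → ℝ≥0∞} (hk : Measurable k) (hg : Measurable g) :
    lpn r μ (fun x => ∫⁻ y, k (x - y) * g y ∂μ) ≤ lpn s μ k * lpn p μ g := by
  have h1s := lpn_inv_toReal_one hs
  have h1p := lpn_inv_toReal_one hp
  have h1r := lpn_inv_toReal_one hr
  have hkx : ∀ x, Measurable fun y => k (x - y) := fun x =>
    hk.comp (measurable_const.sub measurable_id)
  by_cases hrt : r = ∞
  · subst hrt
    refine lpn_top_le (Eventually.of_forall fun x => ?_)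
    simp only [ENNReal.toReal_top, inv_zero, add_zero] at hrsp
    by_cases hst : s = ∞
    · subst hst
      simp only [ENNReal.toReal_top, inv_zero, zero_add] at hrsp
      have := toReal_inv_eq_one hrsp.symm
      subst this
      rw [lpn_one, ← lintegral_const_mul _ hg]
      have h2 : ∀ᵐ y ∂μ, k (x - y) ≤ lpn ∞ μ k :=
        (quasiMeasurePreserving_sub_left μ x).ae (le_lpn_top k)
      refine lintegral_mono_ae ?_
      filter_upwards [h2] with y hy
      gcongr
    by_cases hpt : p = ∞
    · subst hpt
      simp only [ENNReal.toReal_top, inv_zero, add_zero] at hrsp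
      have := toReal_inv_eq_one hrsp.symm
      subst this
      rw [lpn_one, ← lintegral_sub_left_eq_self k x, ← lintegral_mul_const _ (hkx x)]
      refine lintegral_mono_ae ?_
      filter_upwards [le_lpn_top g] with y hy
      gcongr
    have hs0 : 0 < s.toReal := ENNReal.toReal_pos (lt_of_lt_of_le one_pos hs).ne' hst
    have hp0 : 0 < p.toReal := ENNReal.toReal_pos (lt_of_lt_of_le one_pos hp).ne' hpt
    have := ENNReal.lintegral_mul_norm_pow_le (μ := μ) (f := fun y => k (x - y) ^ s.toReal)
      (g := fun y => g y ^ p.toReal) ((hkx x).pow_const _).aemeasurable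
      (hg.pow_const _).aemeasurable (p := s.toReal⁻¹) (q := p.toReal⁻¹) h1s.1 h1p.1 hrsp.symm
    simp only [← ENNReal.rpow_mul, mul_inv_cancel₀ hs0.ne', mul_inv_cancel₀ hp0.ne',
      ENNReal.rpow_one] at this
    rw [lintegral_sub_left_eq_self (fun y => k y ^ s.toReal) x] at this
    simpa only [lpn, hst, hpt, if_false, one_div] using this
  · have hr0 : 0 < r.toReal := ENNReal.toReal_pos (lt_of_lt_of_le one_pos hr).ne' hrt
    have hri : 0 < r.toReal⁻¹ := inv_pos.2 hr0
    have hsi : 0 < s.toReal⁻¹ := by linarith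
    have hpi : 0 < p.toReal⁻¹ := by linarith
    have hs0 : 0 < s.toReal := inv_pos.1 hsi
    have hp0 : 0 < p.toReal := inv_pos.1 hpi
    have hst : s ≠ ∞ := by rintro rfl; simp at hs0
    have hpt : p ≠ ∞ := by rintro rfl; simp at hp0
    simp only [lpn, hrt, hst, hpt, if_false]
    set R := r.toReal
    set S := s.toReal
    set P := p.toReal
    set A := ∫⁻ y, k y ^ S ∂μ with hA
    set B := ∫⁻ y, g y ^ P ∂μ with hB
    have hpt : ∀ x, ∫⁻ y, k (x - y) * g y ∂μ ≤
        (∫⁻ y, k (x - y) ^ S * g y ^ P ∂μ) ^ R⁻¹ * A ^ (S⁻¹ - R⁻¹) * B ^ (P⁻¹ - R⁻¹) := by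
      intro x
      have := ENNReal.lintegral_prod_norm_pow_le (μ := μ) (Finset.univ : Finset (Fin 3))
        (f := ![fun y => k (x - y) ^ S * g y ^ P, fun y => k (x - y) ^ S, fun y => g y ^ P])
        (p := ![R⁻¹, S⁻¹ - R⁻¹, P⁻¹ - R⁻¹])
        (by
          intro i _
          fin_cases i
          · exact (((hkx x).pow_const _).mul (hg.pow_const _)).aemeasurable
          · exact ((hkx x).pow_const _).aemeasurable
          · exact (hg.pow_const _).aemeasurable)
        (by simp [Fin.sum_univ_three]; linarith)
        (by
          intro i _
          fin_cases i
          · exact hri.le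
          · simp; linarith
          · simp; linarith)
      simp only [Fin.prod_univ_three, Matrix.cons_val_zero, Matrix.cons_val_one,
        Matrix.cons_val] at this
      rw [lintegral_sub_left_eq_self (fun y => k y ^ S) x] at this
      refine le_trans (le_of_eq ?_) this
      refine lintegral_congr fun y => ?_
      rw [ENNReal.mul_rpow_of_nonneg _ _ hri.le]
      simp only [← ENNReal.rpow_mul]
      have e1 : k (x - y) = k (x - y) ^ (S * R⁻¹) * k (x - y) ^ (S * (S⁻¹ - R⁻¹)) := by
        rw [← ENNReal.rpow_add_of_nonneg _ _ (by positivity)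
          (mul_nonneg hs0.le (by linarith)), ← mul_add]
        simp [hs0.ne']
      have e2 : g y = g y ^ (P * R⁻¹) * g y ^ (P * (P⁻¹ - R⁻¹)) := by
        rw [← ENNReal.rpow_add_of_nonneg _ _ (by positivity)
          (mul_nonneg hp0.le (by linarith)), ← mul_add]
        simp [hp0.ne']
      conv_lhs => rw [e1, e2]
      ring
    have hAB : ∫⁻ x, ∫⁻ y, k (x - y) ^ S * g y ^ P ∂μ ∂μ = A * B := by
      rw [lintegral_lintegral_swap]
      · have : ∀ y, ∫⁻ x, k (x - y) ^ S * g y ^ P ∂μ = A * g y ^ P := by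
          intro y
          rw [lintegral_mul_const _ (show Measurable fun x => k (x - y) ^ S from
            (hk.comp (measurable_id.sub measurable_const)).pow_const _),
            lintegral_sub_right_eq_self (fun x => k x ^ S) y]
        simp_rw [this]
        rw [lintegral_const_mul _ (hg.pow_const _)]
      · exact (((hk.comp (measurable_fst.sub measurable_snd)).pow_const _).mul
          ((hg.comp measurable_snd).pow_const _)).aemeasurable
    have hfin : ∫⁻ x, (∫⁻ y, k (x - y) * g y ∂μ) ^ R ∂μ ≤
        (A * B) * (A ^ (S⁻¹ - R⁻¹) * B ^ (P⁻¹ - R⁻¹)) ^ R := by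
      rw [← hAB, ← lintegral_mul_const]
      · refine lintegral_mono fun x => ?_
        refine (ENNReal.rpow_le_rpow (hpt x) hr0.le).trans_eq ?_
        rw [mul_assoc, ENNReal.mul_rpow_of_nonneg _ _ hr0.le, ← ENNReal.rpow_mul,
          inv_mul_cancel₀ hr0.ne', ENNReal.rpow_one]
      · exact Measurable.lintegral_prod_right'
          (f := fun z : G × G => k (z.1 - z.2) ^ S * g z.2 ^ P)
          (((hk.comp (measurable_fst.sub measurable_snd)).pow_const _).mul
          ((hg.comp measurable_snd).pow_const _))
    refine (ENNReal.rpow_le_rpow hfin (by positivity)).trans_eq ?_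
    rw [one_div, ENNReal.mul_rpow_of_nonneg _ _ hri.le, ← ENNReal.rpow_mul,
      mul_inv_cancel₀ hr0.ne', ENNReal.rpow_one, ENNReal.mul_rpow_of_nonneg _ _ hri.le]
    have e1 : A ^ (1 / S) = A ^ R⁻¹ * A ^ (S⁻¹ - R⁻¹) := by
      rw [← ENNReal.rpow_add_of_nonneg _ _ hri.le (by linarith)]; congr 1; ring
    have e2 : B ^ (1 / P) = B ^ R⁻¹ * B ^ (P⁻¹ - R⁻¹) := by
      rw [← ENNReal.rpow_add_of_nonneg _ _ hri.le (by linarith)]; congr 1; ring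
    rw [e1, e2]; ring

end young

/-- mixed norm for extended-nonnegative functions -/
def LL (p q : ℝ≥0∞) (g : V3 → ℝ≥0∞) : ℝ≥0∞ :=
  lpn p (volume : Measure (ℝ × ℝ)) fun xh => lpn q (volume : Measure ℝ) fun y => g (xh, y)

lemma LL_mono {p q : ℝ≥0∞} {f g : V3 → ℝ≥0∞} (h : ∀ x, f x ≤ g x) : LL p q f ≤ LL p q g :=
  lpn_mono fun _ => lpn_mono fun _ => h _

lemma LL_add_le {p q : ℝ≥0∞} (hp : 1 ≤ p) (hq : 1 ≤ q) {f g : V3 → ℝ≥0∞}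
    (hf : Measurable f) (hg : Measurable g) :
    LL p q (fun x => f x + g x) ≤ LL p q f + LL p q g := by
  unfold LL
  refine le_trans (lpn_mono fun xh => lpn_add_le hq (hf.comp measurable_prodMk_left)
    (hg.comp measurable_prodMk_left)) ?_
  exact lpn_add_le hp (measurable_lpn hf) (measurable_lpn hg)

lemma mixed_young {p q r s p₁ q₁ : ℝ≥0∞} (hp : 1 ≤ p) (hq : 1 ≤ q) (hr : 1 ≤ r) (hs : 1 ≤ s)
    (hp₁ : 1 ≤ p₁) (hq₁ : 1 ≤ q₁)
    (h1 : 1 + p.toReal⁻¹ = r.toReal⁻¹ + p₁.toReal⁻¹)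
    (h2 : 1 + q.toReal⁻¹ = s.toReal⁻¹ + q₁.toReal⁻¹)
    {A : ℝ × ℝ → ℝ≥0∞} {B : ℝ → ℝ≥0∞} (hA : Measurable A) (hB : Measurable B)
    {g : V3 → ℝ≥0∞} (hg : Measurable g) :
    LL p q (fun x => ∫⁻ y : V3, A (x.1 - y.1) * B (x.2 - y.2) * g y) ≤
      lpn r volume A * lpn s volume B * LL p₁ q₁ g := by
  have hin : ∀ xh : ℝ × ℝ, lpn q (volume : Measure ℝ)
      (fun z => ∫⁻ y : V3, A (xh - y.1) * B (z - y.2) * g y) ≤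
      lpn s volume B * ∫⁻ yh : ℝ × ℝ, A (xh - yh) * lpn q₁ volume (fun z => g (yh, z)) := by
    intro xh
    have hm : Measurable fun w : ℝ × (ℝ × ℝ) × ℝ =>
        A (xh - w.2.1) * B (w.1 - w.2.2) * g w.2 := by fun_prop
    have hm0 : Measurable fun w : (ℝ × ℝ × ℝ) × ℝ => B (w.1.1 - w.2) * g (w.1.2, w.2) := by
      fun_prop
    have hm1 : Measurable fun w : ℝ × ℝ × ℝ => ∫⁻ z', B (w.1 - z') * g (w.2, z') :=
      Measurable.lintegral_prod_right' hm0
    have e : ∀ z, ∫⁻ y : V3, A (xh - y.1) * B (z - y.2) * g y =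
        ∫⁻ yh : ℝ × ℝ, A (xh - yh) * ∫⁻ z', B (z - z') * g (yh, z') := by
      intro z
      rw [Measure.volume_eq_prod, lintegral_prod _ (by fun_prop)]
      refine lintegral_congr fun yh => ?_
      rw [← lintegral_const_mul _ (by fun_prop)]
      simp only [mul_assoc]
    simp_rw [e]
    refine (minkowski (μ := (volume : Measure ℝ)) (ν := (volume : Measure (ℝ × ℝ))) hq
      (F := fun w => A (xh - w.2) * ∫⁻ z', B (w.1 - z') * g (w.2, z'))
      (Measurable.mul (by fun_prop) hm1)).trans ?_
    rw [← lintegral_const_mul _ (show Measurable fun yh => A (xh - yh) *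
      lpn q₁ volume (fun z => g (yh, z)) from
      (by fun_prop : Measurable fun yh => A (xh - yh)).mul (measurable_lpn hg))]
    refine lintegral_mono fun yh => ?_
    simp only
    rw [lpn_const_mul hq _ (show Measurable fun x => ∫⁻ z', B (x - z') * g (yh, z') from
      hm1.comp measurable_prodMk_right)]
    calc _ ≤ A (xh - yh) * (lpn s volume B * lpn q₁ volume (fun z => g (yh, z))) := by
          gcongr
          exact young hq hs hq₁ h2 hB (hg.comp measurable_prodMk_left)
      _ = _ := by ring
  have hmA : Measurable fun w : (ℝ × ℝ) × (ℝ × ℝ) =>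
      A (w.1 - w.2) * lpn q₁ volume (fun z => g (w.2, z)) :=
    Measurable.mul (by fun_prop) ((measurable_lpn hg).comp measurable_snd)
  unfold LL
  refine (lpn_mono hin).trans ?_
  rw [lpn_const_mul hp _ (Measurable.lintegral_prod_right' hmA)]
  calc _ ≤ lpn s volume B * (lpn r volume A * lpn p₁ volume
          fun xh => lpn q₁ volume (fun z => g (xh, z))) := by
        refine mul_le_mul_right ?_ _
        exact young (μ := (volume : Measure (ℝ × ℝ))) (k := A)
          (g := fun xh => lpn q₁ volume (fun z => g (xh, z))) hp hr hp₁ h1 hA (measurable_lpn hg)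
    _ = _ := by ring

/-- measurable lower envelope -/
lemma exists_envelope {α : Type*} [MeasurableSpace α] (μ : Measure α) [SigmaFinite μ]
    (F : α → ℝ≥0∞) (hF : ∀ x, F x ≠ ∞) :
    ∃ g : α → ℝ≥0∞, Measurable g ∧ (∀ x, g x ≤ F x) ∧
      ∀ k : α → ℝ≥0∞, Measurable k → (∀ x, k x ≠ 0) → (∀ x, k x ≠ ∞) →
        ∫⁻ x, k x * F x ∂μ ≤ ∫⁻ x, k x * g x ∂μ := by
  obtain ⟨ν, hν, hμν, -⟩ := exists_isFiniteMeasure_absolutelyContinuous μ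
  have h1 : ∀ n : ℕ, ∃ g, Measurable g ∧ g ≤ (fun x => min (F x) n) ∧
      ∫⁻ x, min (F x) n ∂ν = ∫⁻ x, g x ∂ν := fun n => exists_measurable_le_lintegral_eq ν _
  choose g hgm hgF hgi using h1
  have hfin : ∀ n, ∫⁻ x, g n x ∂ν ≠ ∞ := by
    intro n
    have : ∫⁻ x, g n x ∂ν ≤ ∫⁻ _, (n : ℝ≥0∞) ∂ν :=
      lintegral_mono fun x => (hgF n x).trans (min_le_right _ _)
    refine ne_top_of_le_ne_top ?_ this
    simp [lintegral_const, ENNReal.mul_eq_top]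
  have hmax : ∀ (n : ℕ) (h : α → ℝ≥0∞), Measurable h → (∀ x, h x ≤ min (F x) n) →
      ∀ᵐ x ∂ν, h x ≤ g n x := by
    intro n h hm hle
    have h2 : ∫⁻ x, max (h x) (g n x) ∂ν ≤ ∫⁻ x, g n x ∂ν := by
      rw [← hgi n]
      exact lintegral_mono fun x => max_le (hle x) (hgF n x)
    have h3 := ae_eq_of_ae_le_of_lintegral_le (μ := ν) (f := g n) (g := fun x => max (h x) (g n x))
      (Eventually.of_forall fun x => le_max_right _ _) (hfin n) (hm.max (hgm n)).aemeasurable h2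
    filter_upwards [h3] with x hx
    rw [hx]; exact le_max_left _ _
  refine ⟨fun x => ⨆ n, g n x, Measurable.iSup hgm,
    fun x => iSup_le fun n => (hgF n x).trans (min_le_left _ _), ?_⟩
  intro k hk hk0 hkt
  obtain ⟨h, hhm, hhle, hhi⟩ := exists_measurable_le_lintegral_eq μ (fun x => k x * F x)
  rw [hhi]
  have hle : ∀ x, h x / k x ≤ F x := fun x => by
    rw [ENNReal.div_le_iff (hk0 x) (hkt x), mul_comm]; exact hhle x
  have h4 : ∀ᵐ x ∂ν, ∀ n : ℕ, min (h x / k x) n ≤ g n x := by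
    rw [ae_all_iff]
    intro n
    exact hmax n _ ((hhm.div hk).min measurable_const) fun x => min_le_min (hle x) le_rfl
  refine lintegral_mono_ae ?_
  filter_upwards [hμν.ae_le h4] with x hx
  obtain ⟨n, hn⟩ := ENNReal.exists_nat_gt (hF x)
  have h5 := hx n
  rw [min_eq_left ((hle x).trans hn.le)] at h5
  have h6 := h5.trans (le_iSup (fun n => g n x) n)
  rw [ENNReal.div_le_iff (hk0 x) (hkt x), mul_comm] at h6
  exact h6


def phiM (M t y : ℝ) : ℝ≥0∞ := ENNReal.ofReal ((t + y ^ 2) ^ (-M / 2))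

lemma measurable_phiM (M t : ℝ) : Measurable (phiM M t) := by
  unfold phiM; fun_prop

lemma phiM_ne {M t : ℝ} (ht : 0 < t) (y : ℝ) : phiM M t y ≠ 0 ∧ phiM M t y ≠ ∞ := by
  unfold phiM
  refine ⟨?_, ENNReal.ofReal_ne_top⟩
  have : 0 < (t + y ^ 2) ^ (-M / 2) := by positivity
  simpa using this

lemma phiM_norm (q : ℝ≥0∞) (hq : 1 ≤ q) (M : ℝ) (hM : q.toReal⁻¹ < M) :
    ∃ C > (0 : ℝ), ∀ t : ℝ, 0 < t →
      lpn q volume (phiM M t) ≤ ENNReal.ofReal (C * t ^ ((q.toReal⁻¹ - M) / 2)) := by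
  by_cases h : q = ∞
  · subst h
    refine ⟨1, one_pos, fun t ht => lpn_top_le (Eventually.of_forall fun y => ?_)⟩
    simp only [ENNReal.toReal_top, inv_zero, zero_sub, one_mul] at *
    refine ENNReal.ofReal_le_ofReal ?_
    exact Real.rpow_le_rpow_of_nonpos ht (by nlinarith [sq_nonneg y]) (by linarith)
  · have hQ : 0 < q.toReal := ENNReal.toReal_pos (lt_of_lt_of_le one_pos hq).ne' h
    set Q := q.toReal with hQdef
    have hMQ : 1 < M * Q := by
      rw [inv_lt_iff_one_lt_mul₀ hQ] at hM; linarith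
    have hint : Integrable (fun u : ℝ => (1 + u ^ 2) ^ (-(M * Q) / 2)) := by
      have := integrable_rpow_neg_one_add_norm_sq (E := ℝ) (μ := volume) (r := M * Q) (by simpa)
      simpa using this
    set J := ∫ u : ℝ, (1 + u ^ 2) ^ (-(M * Q) / 2) with hJ
    have hJ0 : 0 ≤ J := integral_nonneg fun u => by positivity
    refine ⟨J ^ (1 / Q) + 1, by positivity, fun t ht => ?_⟩
    have hst : 0 < √t := Real.sqrt_pos.2 ht
    have e1 : ∀ y : ℝ, phiM M t y ^ Q =
        ENNReal.ofReal (t ^ (-(M * Q) / 2) * (1 + (y / √t) ^ 2) ^ (-(M * Q) / 2)) := by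
      intro y
      unfold phiM
      rw [ENNReal.ofReal_rpow_of_nonneg (by positivity) hQ.le, ← Real.rpow_mul (by positivity),
        ← Real.mul_rpow ht.le (by positivity)]
      congr 2
      · rw [div_pow, Real.sq_sqrt ht.le]; field_simp
      · ring
    have hint2 : Integrable (fun y : ℝ =>
        t ^ (-(M * Q) / 2) * (1 + (y / √t) ^ 2) ^ (-(M * Q) / 2)) :=
      (hint.comp_div hst.ne').const_mul _
    have e2 : ∫⁻ y, phiM M t y ^ Q = ENNReal.ofReal (t ^ (-(M * Q) / 2) * (√t * J)) := by
      simp_rw [e1]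
      rw [← ofReal_integral_eq_lintegral_ofReal hint2 (Eventually.of_forall fun y => by positivity),
        integral_const_mul, Measure.integral_comp_div (fun u : ℝ => (1 + u ^ 2) ^ (-(M * Q) / 2)) √t,
        abs_of_pos hst, smul_eq_mul]
    simp only [lpn, h, if_false]
    rw [e2, ENNReal.ofReal_rpow_of_nonneg (by positivity) (by positivity)]
    refine ENNReal.ofReal_le_ofReal ?_
    rw [← mul_assoc, Real.mul_rpow (by positivity) hJ0, Real.sqrt_eq_rpow, ← Real.rpow_add ht,
      ← Real.rpow_mul ht.le]
    have e3 : (-(M * Q) / 2 + 1 / 2) * (1 / Q) = (Q⁻¹ - M) / 2 := by field_simp; ring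
    rw [e3, mul_comm]
    gcongr
    linarith

lemma profile (p q : ℝ≥0∞) (hp : 1 ≤ p) (hq : 1 ≤ q) (M : ℝ)
    (hM : 2 * p.toReal⁻¹ + q.toReal⁻¹ < M) :
    ∃ C > (0 : ℝ), ∃ A : ℝ → ℝ × ℝ → ℝ≥0∞, ∃ B : ℝ → ℝ → ℝ≥0∞, ∀ t : ℝ, 0 < t →
      Measurable (A t) ∧ Measurable (B t) ∧
      (∀ x, A t x ≠ 0 ∧ A t x ≠ ∞) ∧ (∀ y, B t y ≠ 0 ∧ B t y ≠ ∞) ∧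
      (∀ x y, ENNReal.ofReal ((t + x.1 ^ 2 + x.2 ^ 2 + y ^ 2) ^ (-M / 2)) ≤ A t x * B t y) ∧
      lpn p volume (A t) * lpn q volume (B t) ≤
        ENNReal.ofReal (C * t ^ ((2 * p.toReal⁻¹ + q.toReal⁻¹ - M) / 2)) := by
  obtain ⟨δ, hδ, rfl⟩ : ∃ δ > 0, M = 2 * p.toReal⁻¹ + q.toReal⁻¹ + 4 * δ :=
    ⟨(M - (2 * p.toReal⁻¹ + q.toReal⁻¹)) / 4, by linarith, by ring⟩
  have hp0 := (lpn_inv_toReal_one hp).1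
  have hq0 := (lpn_inv_toReal_one hq).1
  set a := p.toReal⁻¹ + δ with ha
  set b := q.toReal⁻¹ + 2 * δ with hb
  obtain ⟨C1, hC1, h1⟩ := phiM_norm p hp a (by linarith)
  obtain ⟨C2, hC2, h2⟩ := phiM_norm q hq b (by linarith)
  refine ⟨C1 * C1 * C2, by positivity, fun t x => phiM a t x.1 * phiM a t x.2, phiM b,
    fun t ht => ⟨?_, measurable_phiM _ _, ?_, phiM_ne ht, ?_, ?_⟩⟩
  · exact ((measurable_phiM a t).comp measurable_fst).mul
      ((measurable_phiM a t).comp measurable_snd)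
  · exact fun x => ⟨mul_ne_zero (phiM_ne ht _).1 (phiM_ne ht _).1,
      ENNReal.mul_ne_top (phiM_ne ht _).2 (phiM_ne ht _).2⟩
  · intro x y
    unfold phiM
    dsimp only
    rw [← ENNReal.ofReal_mul (by positivity), ← ENNReal.ofReal_mul (by positivity)]
    refine ENNReal.ofReal_le_ofReal ?_
    have hS : 0 < t + x.1 ^ 2 + x.2 ^ 2 + y ^ 2 := by positivity
    rw [show -(2 * p.toReal⁻¹ + q.toReal⁻¹ + 4 * δ) / 2 = -a / 2 + -a / 2 + -b / 2 by
      rw [ha, hb]; ring, Real.rpow_add hS, Real.rpow_add hS]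
    have k1 : (t + x.1 ^ 2 + x.2 ^ 2 + y ^ 2) ^ (-a / 2) ≤ (t + x.1 ^ 2) ^ (-a / 2) :=
      Real.rpow_le_rpow_of_nonpos (by positivity) (by nlinarith [sq_nonneg y, sq_nonneg x.2])
        (by linarith)
    have k2 : (t + x.1 ^ 2 + x.2 ^ 2 + y ^ 2) ^ (-a / 2) ≤ (t + x.2 ^ 2) ^ (-a / 2) :=
      Real.rpow_le_rpow_of_nonpos (by positivity) (by nlinarith [sq_nonneg y, sq_nonneg x.1])
        (by linarith)
    have k3 : (t + x.1 ^ 2 + x.2 ^ 2 + y ^ 2) ^ (-b / 2) ≤ (t + y ^ 2) ^ (-b / 2) :=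
      Real.rpow_le_rpow_of_nonpos (by positivity) (by nlinarith [sq_nonneg x.1, sq_nonneg x.2])
        (by linarith)
    gcongr
  · have hA : lpn p (volume : Measure (ℝ × ℝ)) (fun x => phiM a t x.1 * phiM a t x.2) ≤
        lpn p volume (phiM a t) * lpn p volume (phiM a t) := by
      by_cases h : p = ∞
      · subst h
        have hb : ∀ y, phiM a t y ≤ ENNReal.ofReal (t ^ (-a / 2)) := fun y =>
          ENNReal.ofReal_le_ofReal (Real.rpow_le_rpow_of_nonpos ht (by nlinarith [sq_nonneg y])
            (by linarith))
        have m1 : ∀ᵐ x : ℝ × ℝ, phiM a t x.1 ≤ lpn ∞ volume (phiM a t) :=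
          Measure.quasiMeasurePreserving_fst.ae (le_lpn_top (phiM a t))
        have m2 : ∀ᵐ x : ℝ × ℝ, phiM a t x.2 ≤ lpn ∞ volume (phiM a t) :=
          Measure.quasiMeasurePreserving_snd.ae (le_lpn_top (phiM a t))
        apply lpn_top_le
        filter_upwards [m1, m2] with x h1 h2
        gcongr
      · simp only [lpn, h, if_false]
        have hP : 0 < p.toReal := ENNReal.toReal_pos (lt_of_lt_of_le one_pos hp).ne' h
        rw [← ENNReal.mul_rpow_of_nonneg _ _ (by positivity), Measure.volume_eq_prod,
          ← lintegral_prod_mul ((measurable_phiM a t).pow_const _).aemeasurable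
            ((measurable_phiM a t).pow_const _).aemeasurable]
        simp_rw [ENNReal.mul_rpow_of_nonneg _ _ hP.le]
        exact le_rfl
    calc _ ≤ (ENNReal.ofReal (C1 * t ^ ((p.toReal⁻¹ - a) / 2)) *
          ENNReal.ofReal (C1 * t ^ ((p.toReal⁻¹ - a) / 2))) *
          ENNReal.ofReal (C2 * t ^ ((q.toReal⁻¹ - b) / 2)) :=
          mul_le_mul' (hA.trans (mul_le_mul' (h1 t ht) (h1 t ht))) (h2 t ht)
      _ = _ := by
        rw [← ENNReal.ofReal_mul (by positivity), ← ENNReal.ofReal_mul (by positivity)]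
        congr 1
        rw [show (2 * p.toReal⁻¹ + q.toReal⁻¹ - (2 * p.toReal⁻¹ + q.toReal⁻¹ + 4 * δ)) / 2 =
          (p.toReal⁻¹ - a) / 2 + (p.toReal⁻¹ - a) / 2 + (q.toReal⁻¹ - b) / 2 by
          rw [ha, hb]; ring, Real.rpow_add ht, Real.rpow_add ht]
        ring


def kS (t : ℝ) (x : V3) : ℝ := t + x.1.1 ^ 2 + x.1.2 ^ 2 + x.2 ^ 2

lemma kS_pos {t : ℝ} (ht : 0 < t) (x : V3) : 0 < kS t x := by unfold kS; positivity

lemma measurable_kS (t : ℝ) : Measurable (kS t) := by unfold kS; fun_prop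

def kM (M t : ℝ) (x : V3) : ℝ≥0∞ := ENNReal.ofReal (kS t x ^ (-M / 2))

lemma measurable_kM (M t : ℝ) : Measurable (kM M t) := by
  unfold kM; exact ((measurable_kS t).pow_const _).ennreal_ofReal

lemma measurable_wxh : Measurable wxh := by unfold wxh; fun_prop

lemma wxh_nonneg (x : V3) : 0 ≤ wxh x := Real.sqrt_nonneg _

lemma wxh_le (t : ℝ) (ht : 0 < t) (x : V3) : wxh x ≤ kS t x ^ ((1 : ℝ) / 2) := by
  rw [← Real.sqrt_eq_rpow]
  unfold wxh kS
  exact Real.sqrt_le_sqrt (by nlinarith [sq_nonneg x.2])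

lemma wxh_add_le (x y : V3) : wxh x ≤ wxh (x - y) + wxh y := by
  have h : ∀ x : V3, wxh x = ‖(⟨x.1.1, x.1.2⟩ : ℂ)‖ := fun x => by
    rw [Complex.norm_def, Complex.normSq_mk, wxh, sq, sq]
  rw [h, h, h]
  refine le_trans (le_of_eq ?_) (norm_add_le _ _)
  congr 1
  apply Complex.ext <;> simp

lemma inv_toReal_anti {p p₁ : ℝ≥0∞} (h1 : 1 ≤ p₁) (h : p₁ ≤ p) :
    p.toReal⁻¹ ≤ p₁.toReal⁻¹ := by
  by_cases hp : p = ∞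
  · simp [hp]
  · have : 0 < p₁.toReal := ENNReal.toReal_pos (lt_of_lt_of_le one_pos h1).ne'
      (ne_top_of_le_ne_top hp h)
    exact inv_anti₀ this (ENNReal.toReal_mono hp h)

lemma exists_exponent (ρ : ℝ) (h0 : 0 ≤ ρ) (h1 : ρ ≤ 1) :
    ∃ r : ℝ≥0∞, 1 ≤ r ∧ r.toReal⁻¹ = ρ := by
  refine ⟨(ENNReal.ofReal ρ)⁻¹, ?_, ?_⟩
  · rw [ENNReal.one_le_inv]; exact ENNReal.ofReal_le_one.2 h1
  · rw [ENNReal.toReal_inv, inv_inv, ENNReal.toReal_ofReal h0]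

lemma conv_part {p q p₁ q₁ : ℝ≥0∞} (hp : 1 ≤ p) (hq : 1 ≤ q) (hp₁ : 1 ≤ p₁) (hq₁ : 1 ≤ q₁)
    (hpp : p₁ ≤ p) (hqq : q₁ ≤ q) (M : ℝ)
    (hM : 2 * (1 + p.toReal⁻¹ - p₁.toReal⁻¹) + (1 + q.toReal⁻¹ - q₁.toReal⁻¹) < M) :
    ∃ C > (0 : ℝ), ∀ t : ℝ, 0 < t → ∀ g : V3 → ℝ≥0∞, Measurable g →
      LL p q (fun x => ∫⁻ y : V3, kM M t (x - y) * g y) ≤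
        ENNReal.ofReal (C * t ^ ((2 * (1 + p.toReal⁻¹ - p₁.toReal⁻¹) +
          (1 + q.toReal⁻¹ - q₁.toReal⁻¹) - M) / 2)) * LL p₁ q₁ g := by
  have a1 := lpn_inv_toReal_one hp
  have a2 := lpn_inv_toReal_one hq
  have a3 := lpn_inv_toReal_one hp₁
  have a4 := lpn_inv_toReal_one hq₁
  have a5 := inv_toReal_anti hp₁ hpp
  have a6 := inv_toReal_anti hq₁ hqq
  obtain ⟨r, hr, hrr⟩ := exists_exponent (1 + p.toReal⁻¹ - p₁.toReal⁻¹) (by linarith) (by linarith)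
  obtain ⟨s, hs, hss⟩ := exists_exponent (1 + q.toReal⁻¹ - q₁.toReal⁻¹) (by linarith) (by linarith)
  rw [← hrr, ← hss] at hM ⊢
  obtain ⟨C, hC, A, B, h⟩ := profile r s hr hs M hM
  refine ⟨C, hC, fun t ht g hg => ?_⟩
  obtain ⟨hA, hB, -, -, hle, hn⟩ := h t ht
  calc _ ≤ LL p q (fun x => ∫⁻ y : V3, A t (x.1 - y.1) * B t (x.2 - y.2) * g y) := by
        refine LL_mono fun x => lintegral_mono fun y => ?_
        exact mul_le_mul_left (hle (x.1 - y.1) (x.2 - y.2)) _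
    _ ≤ lpn r volume (A t) * lpn s volume (B t) * LL p₁ q₁ g :=
        mixed_young hp hq hr hs hp₁ hq₁ (by linarith) (by linarith) hA hB hg
    _ ≤ _ := mul_le_mul_left hn _

lemma measurable_convM (M t : ℝ) {g : V3 → ℝ≥0∞} (hg : Measurable g) :
    Measurable fun x => ∫⁻ y : V3, kM M t (x - y) * g y :=
  Measurable.lintegral_prod_right' (f := fun z : V3 × V3 => kM M t (z.1 - z.2) * g z.2)
    (((measurable_kM M t).comp (measurable_fst.sub measurable_snd)).mul (hg.comp measurable_snd))

lemma LL_const_mul {p q : ℝ≥0∞} (hp : 1 ≤ p) (hq : 1 ≤ q) (c : ℝ≥0∞) {f : V3 → ℝ≥0∞}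
    (hf : Measurable f) : LL p q (fun x => c * f x) = c * LL p q f := by
  unfold LL
  simp_rw [fun xh : ℝ × ℝ => lpn_const_mul (μ := (volume : Measure ℝ)) hq c
    (show Measurable fun y => f (xh, y) from hf.comp measurable_prodMk_left)]
  exact lpn_const_mul hp c (measurable_lpn hf)

lemma part_one {p q : ℝ≥0∞} (hp : 1 ≤ p) (hq : 1 ≤ q) (N m : ℕ) (K : ℝ → V3 → ℝ)
    (C₀ : ℝ) (hC₀ : 0 < C₀)
    (hK : ∀ t, 0 < t → ∀ x : V3, x.2 ≠ 0 → |K t x| ≤ C₀ * kS t x ^ (-((N : ℝ) + 1) / 2))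
    (hcond : (2 : ℝ) * p.toReal⁻¹ + q.toReal⁻¹ - 1 + (m : ℝ) < (N : ℝ)) :
    ∃ C > (0 : ℝ), ∀ t : ℝ, 0 < t →
      LhLv p q (fun x => wxh x ^ m * K t x) ≤
        ENNReal.ofReal
          (C * t ^ (-(1 - p.toReal⁻¹) - (1 / 2 : ℝ) * (1 - q.toReal⁻¹) -
            ((N : ℝ) - 2) / 2 + (m : ℝ) / 2)) := by
  obtain ⟨C, hC, A, B, h⟩ := profile p q hp hq ((N : ℝ) + 1 - m) (by linarith)
  refine ⟨C₀ * C, by positivity, fun t ht => ?_⟩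
  obtain ⟨hA, hB, -, -, hle, hn⟩ := h t ht
  have key : LhLv p q (fun x => wxh x ^ m * K t x) ≤
      LL p q (fun x => ENNReal.ofReal C₀ * (A t x.1 * B t x.2)) := by
    refine lpn_mono fun xh => lpn_mono_ae ?_
    have : ∀ᵐ y : ℝ, y ≠ 0 := by simp [ae_iff]
    filter_upwards [this] with y hy
    refine le_trans ?_ (mul_le_mul_right (hle xh y) _)
    rw [← ENNReal.ofReal_mul hC₀.le]
    refine ENNReal.ofReal_le_ofReal ?_
    have hS := kS_pos ht (xh, y)
    have h1 := hK t ht (xh, y) hy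
    have h2 : wxh (xh, y) ^ m ≤ kS t (xh, y) ^ ((m : ℝ) / 2) := by
      refine (pow_le_pow_left₀ (wxh_nonneg _) (wxh_le t ht _) m).trans_eq ?_
      rw [← Real.rpow_natCast, ← Real.rpow_mul hS.le]; congr 1; ring
    rw [abs_mul, abs_of_nonneg (pow_nonneg (wxh_nonneg _) m)]
    calc _ ≤ kS t (xh, y) ^ ((m : ℝ) / 2) * (C₀ * kS t (xh, y) ^ (-((N : ℝ) + 1) / 2)) := by
          gcongr
      _ = C₀ * kS t (xh, y) ^ (-((N : ℝ) + 1 - m) / 2) := by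
          rw [mul_left_comm, ← Real.rpow_add hS]; congr 2; ring
  refine key.trans ?_
  rw [LL_const_mul hp hq _ (show Measurable fun x : V3 => A t x.1 * B t x.2 from
    (hA.comp measurable_fst).mul (hB.comp measurable_snd))]
  have : LL p q (fun x => A t x.1 * B t x.2) = lpn p volume (A t) * lpn q volume (B t) := by
    unfold LL
    simp_rw [fun xh : ℝ × ℝ => lpn_const_mul (μ := (volume : Measure ℝ)) hq (A t xh) hB]
    simp_rw [mul_comm _ (lpn q volume (B t))]
    rw [lpn_const_mul hp _ hA]
  rw [this]
  refine (mul_le_mul_right hn _).trans_eq ?_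
  rw [← ENNReal.ofReal_mul hC₀.le, ← mul_assoc]
  congr 3
  ring

lemma conv_abs (N : ℕ) (K : V3 → ℝ) (C₀ t : ℝ) (hC₀ : 0 < C₀) (ht : 0 < t)
    (hK : ∀ x : V3, x.2 ≠ 0 → |K x| ≤ C₀ * kS t x ^ (-((N : ℝ) + 1) / 2)) (f : V3 → ℝ)
    (g : V3 → ℝ≥0∞)
    (henv : ∀ w : V3 → ℝ≥0∞, Measurable w → (∀ y, w y ≠ 0) → (∀ y, w y ≠ ∞) →
      ∫⁻ y, w y * ENNReal.ofReal |f y| ≤ ∫⁻ y, w y * g y) (x : V3) :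
    ENNReal.ofReal |conv3 K f x| ≤
        ENNReal.ofReal C₀ * ∫⁻ y : V3, kM ((N : ℝ) + 1) t (x - y) * g y := by
  have hkm : Measurable fun y : V3 => kM ((N : ℝ) + 1) t (x - y) :=
    (measurable_kM _ _).comp (measurable_const.sub measurable_id)
  have c1 : ENNReal.ofReal |conv3 K f x| ≤
      ∫⁻ y : V3, ENNReal.ofReal |K (x - y) * f y| := by
    have := enorm_integral_le_lintegral_enorm (μ := (volume : Measure V3))
      (fun y : V3 => K (x - y) * f y)
    simpa only [Real.enorm_eq_ofReal_abs, conv3] using this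
  have hae : ∀ᵐ y : V3, (x - y).2 ≠ 0 := by
    have : ∀ᵐ z : ℝ, x.2 - z ≠ 0 := by
      have h0 : ∀ᵐ z : ℝ, z ≠ x.2 := by simp [ae_iff]
      filter_upwards [h0] with z hz
      exact sub_ne_zero.2 (Ne.symm hz)
    exact (Measure.quasiMeasurePreserving_snd (μ := (volume : Measure (ℝ × ℝ)))
      (ν := (volume : Measure ℝ))).ae this
  have c2 : ∫⁻ y : V3, ENNReal.ofReal |K (x - y) * f y| ≤
      ∫⁻ y : V3, ENNReal.ofReal C₀ *
        (kM ((N : ℝ) + 1) t (x - y) * ENNReal.ofReal |f y|) := by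
    refine lintegral_mono_ae ?_
    filter_upwards [hae] with y hy
    unfold kM
    rw [← mul_assoc, ← ENNReal.ofReal_mul hC₀.le, abs_mul, ENNReal.ofReal_mul (abs_nonneg _)]
    exact mul_le_mul_left (ENNReal.ofReal_le_ofReal (hK _ hy)) _
  refine c1.trans (c2.trans ?_)
  rw [lintegral_const_mul' _ _ ENNReal.ofReal_ne_top]
  refine mul_le_mul_right (henv _ hkm (fun y => ?_) (fun y => ENNReal.ofReal_ne_top)) _
  have : 0 < kS t (x - y) ^ (-((N : ℝ) + 1) / 2) := Real.rpow_pos_of_pos (kS_pos ht _) _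
  simpa [kM] using this

lemma wsplit (N : ℕ) (t : ℝ) (ht : 0 < t) {g W : V3 → ℝ≥0∞} (hg : Measurable g)
    (hW : W = fun x => ENNReal.ofReal (wxh x)) (x : V3) :
    W x * ∫⁻ y : V3, kM ((N : ℝ) + 1) t (x - y) * g y ≤
      (∫⁻ y : V3, kM N t (x - y) * g y) +
        ∫⁻ y : V3, kM ((N : ℝ) + 1) t (x - y) * (W y * g y) := by
  have hm : Measurable fun y : V3 => kM N t (x - y) * g y :=
    (show Measurable fun y : V3 => kM N t (x - y) from
      (measurable_kM _ _).comp (measurable_const.sub measurable_id)).mul hg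
  have hWx : W x ≠ ∞ := by rw [hW]; exact ENNReal.ofReal_ne_top
  rw [← lintegral_const_mul' _ _ hWx, ← lintegral_add_left hm]
  refine lintegral_mono fun y => ?_
  have hWz : ∀ z, W z = ENNReal.ofReal (wxh z) := fun z => by rw [hW]
  have d1 : W x ≤ W (x - y) + W y := by
    rw [hWz, hWz, hWz]
    rw [← ENNReal.ofReal_add (wxh_nonneg _) (wxh_nonneg _)]
    exact ENNReal.ofReal_le_ofReal (wxh_add_le x y)
  have d2 : W (x - y) * kM ((N : ℝ) + 1) t (x - y) ≤ kM N t (x - y) := by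
    rw [hWz]; unfold kM
    rw [← ENNReal.ofReal_mul (wxh_nonneg _)]
    refine ENNReal.ofReal_le_ofReal ?_
    have hS := kS_pos ht (x - y)
    calc _ ≤ kS t (x - y) ^ ((1 : ℝ) / 2) * kS t (x - y) ^ (-((N : ℝ) + 1) / 2) :=
          mul_le_mul_of_nonneg_right (wxh_le t ht _) (Real.rpow_nonneg hS.le _)
      _ = _ := by rw [← Real.rpow_add hS]; congr 1; ring
  calc W x * (kM ((N : ℝ) + 1) t (x - y) * g y)
      ≤ (W (x - y) + W y) * (kM ((N : ℝ) + 1) t (x - y) * g y) := mul_le_mul_left d1 _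
    _ = (W (x - y) * kM ((N : ℝ) + 1) t (x - y)) * g y +
        kM ((N : ℝ) + 1) t (x - y) * (W y * g y) := by ring
    _ ≤ _ := add_le_add (mul_le_mul_left d2 _) le_rfl

lemma part_two {p q : ℝ≥0∞} (hp : 1 ≤ p) (hq : 1 ≤ q) (N : ℕ) (K : ℝ → V3 → ℝ)
    (C₀ : ℝ) (hC₀ : 0 < C₀)
    (hK : ∀ t, 0 < t → ∀ x : V3, x.2 ≠ 0 → |K t x| ≤ C₀ * kS t x ^ (-((N : ℝ) + 1) / 2))
    (p₁ p₂ q₁ q₂ : ℝ≥0∞) (hp₁ : 1 ≤ p₁) (hp₂ : 1 ≤ p₂) (hq₁ : 1 ≤ q₁) (hq₂ : 1 ≤ q₂)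
    (hpp₁ : p₁ ≤ p) (hpp₂ : p₂ ≤ p) (hqq₁ : q₁ ≤ q) (hqq₂ : q₂ ≤ q)
    (h1 : (0 : ℝ) < (p₁.toReal⁻¹ - p.toReal⁻¹) + (1 / 2 : ℝ) * (q₁.toReal⁻¹ - q.toReal⁻¹) +
        ((N : ℝ) - 3) / 2)
    (h2 : (0 : ℝ) < (p₂.toReal⁻¹ - p.toReal⁻¹) + (1 / 2 : ℝ) * (q₂.toReal⁻¹ - q.toReal⁻¹) +
        ((N : ℝ) - 2) / 2) :
      ∃ C > (0 : ℝ), ∀ t : ℝ, 0 < t → ∀ f : V3 → ℝ,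
          LhLv p q (fun x => wxh x * conv3 (K t) f x) ≤
            ENNReal.ofReal
                (C * t ^ (-(p₁.toReal⁻¹ - p.toReal⁻¹) -
                  (1 / 2 : ℝ) * (q₁.toReal⁻¹ - q.toReal⁻¹) -
                  ((N : ℝ) - 3) / 2)) * LhLv p₁ q₁ f +
            ENNReal.ofReal
                (C * t ^ (-(p₂.toReal⁻¹ - p.toReal⁻¹) -
                  (1 / 2 : ℝ) * (q₂.toReal⁻¹ - q.toReal⁻¹) -
                  ((N : ℝ) - 2) / 2)) *
              LhLv p₂ q₂ (fun x => wxh x * f x) := by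
  obtain ⟨C1, hC1, hc1⟩ := conv_part hp hq hp₁ hq₁ hpp₁ hqq₁ (N : ℝ) (by linarith)
  obtain ⟨C2, hC2, hc2⟩ := conv_part hp hq hp₂ hq₂ hpp₂ hqq₂ ((N : ℝ) + 1) (by linarith)
  refine ⟨C₀ * (C1 + C2), by positivity, fun t ht f => ?_⟩
  obtain ⟨g, hg, hgf, henv⟩ := exists_envelope (volume : Measure V3)
    (fun x => ENNReal.ofReal |f x|) (fun x => ENNReal.ofReal_ne_top)
  obtain ⟨W, hW⟩ : ∃ W : V3 → ℝ≥0∞, W = fun x => ENNReal.ofReal (wxh x) := ⟨_, rfl⟩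
  have hWm : Measurable W := by rw [hW]; exact measurable_wxh.ennreal_ofReal
  have hWz : ∀ z, W z = ENNReal.ofReal (wxh z) := fun z => by rw [hW]
  have hWg : Measurable fun y => W y * g y := hWm.mul hg
  obtain ⟨I1, hI1e⟩ : ∃ I1 : V3 → ℝ≥0∞, I1 = fun x => ∫⁻ y : V3, kM N t (x - y) * g y := ⟨_, rfl⟩
  obtain ⟨I2, hI2e⟩ : ∃ I2 : V3 → ℝ≥0∞,
    I2 = fun x => ∫⁻ y : V3, kM ((N : ℝ) + 1) t (x - y) * (W y * g y) := ⟨_, rfl⟩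
  have hI1 : Measurable I1 := by rw [hI1e]; exact measurable_convM _ _ hg
  have hI2 : Measurable I2 := by rw [hI2e]; exact measurable_convM _ _ hWg
  have hpt : ∀ x, ENNReal.ofReal |wxh x * conv3 (K t) f x| ≤
      ENNReal.ofReal C₀ * (I1 x + I2 x) := by
    intro x
    have b1 := conv_abs N (K t) C₀ t hC₀ ht (hK t ht) f g henv x
    rw [abs_mul, abs_of_nonneg (wxh_nonneg x), ENNReal.ofReal_mul (wxh_nonneg x)]
    refine (mul_le_mul_right b1 _).trans ?_
    rw [mul_left_comm]
    rw [hI1e, hI2e, ← hWz]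
    exact mul_le_mul_right (wsplit N t ht hg hW x) _
  have e1 : LhLv p q (fun x => wxh x * conv3 (K t) f x) ≤
      ENNReal.ofReal C₀ * (LL p q I1 + LL p q I2) := by
    calc LhLv p q (fun x => wxh x * conv3 (K t) f x) ≤ LL p q (fun x => ENNReal.ofReal C₀ * (I1 x + I2 x)) :=
          LL_mono (f := fun x => ENNReal.ofReal |wxh x * conv3 (K t) f x|) hpt
      _ = ENNReal.ofReal C₀ * LL p q (fun x => I1 x + I2 x) :=
          LL_const_mul hp hq _ (hI1.add hI2)
      _ ≤ _ := mul_le_mul_right (LL_add_le hp hq hI1 hI2) _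
  have g1 : LL p₁ q₁ g ≤ LhLv p₁ q₁ f :=
    LL_mono (f := g) (g := fun x => ENNReal.ofReal |f x|) hgf
  have g2 : LL p₂ q₂ (fun y => W y * g y) ≤ LhLv p₂ q₂ (fun x => wxh x * f x) := by
    refine LL_mono (f := fun y => W y * g y) (g := fun x => ENNReal.ofReal |wxh x * f x|)
      fun x => ?_
    rw [abs_mul, abs_of_nonneg (wxh_nonneg x), ENNReal.ofReal_mul (wxh_nonneg x), hWz]
    exact mul_le_mul_right (hgf x) _
  have j1 := (hc1 t ht g hg).trans (mul_le_mul_right g1 _)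
  have j2 := (hc2 t ht _ hWg).trans (mul_le_mul_right g2 _)
  rw [← hI1e] at j1
  rw [← hI2e] at j2
  clear hc1 hc2 g1 g2 hpt
  refine e1.trans ?_
  rw [mul_add]
  refine add_le_add ?_ ?_
  · refine (mul_le_mul_right j1 _).trans ?_
    rw [← mul_assoc, ← ENNReal.ofReal_mul hC₀.le, ← mul_assoc]
    refine mul_le_mul_left (ENNReal.ofReal_le_ofReal ?_) _
    rw [show (2 * (1 + p.toReal⁻¹ - p₁.toReal⁻¹) + (1 + q.toReal⁻¹ - q₁.toReal⁻¹) - (N : ℝ)) / 2 =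
      -(p₁.toReal⁻¹ - p.toReal⁻¹) - (1 / 2 : ℝ) * (q₁.toReal⁻¹ - q.toReal⁻¹) -
                  ((N : ℝ) - 3) / 2 by ring]
    gcongr
    linarith
  · refine (mul_le_mul_right j2 _).trans ?_
    rw [← mul_assoc, ← ENNReal.ofReal_mul hC₀.le, ← mul_assoc]
    refine mul_le_mul_left (ENNReal.ofReal_le_ofReal ?_) _
    rw [show (2 * (1 + p.toReal⁻¹ - p₂.toReal⁻¹) + (1 + q.toReal⁻¹ - q₂.toReal⁻¹) -
        ((N : ℝ) + 1)) / 2 =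
      -(p₂.toReal⁻¹ - p.toReal⁻¹) - (1 / 2 : ℝ) * (q₂.toReal⁻¹ - q.toReal⁻¹) -
                  ((N : ℝ) - 2) / 2 by ring]
    gcongr
    linarith


lemma mom_integrable (n : ℕ) {τ : ℝ} (hτ : 0 < τ) :
    Integrable fun ξ : ℝ => |ξ| ^ n * Real.exp (-τ * ξ ^ 2) := by
  have h := (integrable_rpow_mul_exp_neg_mul_sq hτ (s := (n : ℝ))
    (by have : (0 : ℝ) ≤ n := n.cast_nonneg
        linarith)).norm
  refine h.congr (Eventually.of_forall fun ξ => ?_)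
  simp [Real.rpow_natCast]

lemma mom_le (n : ℕ) : ∃ C > (0 : ℝ), ∀ τ : ℝ, 0 < τ →
    ∫ ξ : ℝ, |ξ| ^ n * Real.exp (-τ * ξ ^ 2) ≤ C * τ ^ (-((n : ℝ) + 1) / 2) := by
  have hn : (0 : ℝ) ≤ n := n.cast_nonneg
  refine ⟨2 * (1 / 2 * Real.Gamma (((n : ℝ) + 1) / 2)), ?_, fun τ hτ => ?_⟩
  · have := Real.Gamma_pos_of_pos (show 0 < ((n : ℝ) + 1) / 2 by positivity)
    positivity
  have h1 : ∫ ξ : ℝ, |ξ| ^ n * Real.exp (-τ * ξ ^ 2) =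
      ∫ ξ : ℝ, (fun y : ℝ => y ^ n * Real.exp (-τ * y ^ 2)) |ξ| := by
    simp
  rw [h1, integral_comp_abs (f := fun y : ℝ => y ^ n * Real.exp (-τ * y ^ 2))]
  have h2 := integral_rpow_mul_exp_neg_mul_rpow (p := 2) (q := n) (b := τ) (by norm_num)
    (by linarith) hτ
  have h3 : ∫ x in Set.Ioi (0 : ℝ), x ^ n * Real.exp (-τ * x ^ 2) =
      ∫ x in Set.Ioi (0 : ℝ), x ^ (n : ℝ) * Real.exp (-τ * x ^ (2 : ℝ)) := by
    simp [Real.rpow_natCast]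
  rw [h3, h2]
  apply le_of_eq
  rw [neg_div]
  ring

/-- one-dimensional oscillatory Gaussian moments -/
def hG (n : ℕ) (τ y : ℝ) : ℂ :=
  ∫ ξ : ℝ, Complex.exp (Complex.I * ((y * ξ : ℝ) : ℂ)) * ((ξ ^ n * Real.exp (-τ * ξ ^ 2) : ℝ) : ℂ)

lemma norm_osc (a : ℝ) : ‖Complex.exp (Complex.I * (a : ℂ))‖ = 1 := by
  rw [mul_comm]; exact Complex.norm_exp_ofReal_mul_I a

lemma hG_integrable (n : ℕ) {τ : ℝ} (hτ : 0 < τ) (y : ℝ) :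
    Integrable fun ξ : ℝ => Complex.exp (Complex.I * ((y * ξ : ℝ) : ℂ)) *
      ((ξ ^ n * Real.exp (-τ * ξ ^ 2) : ℝ) : ℂ) := by
  refine (mom_integrable n hτ).mono' ?_ (Eventually.of_forall fun ξ => ?_)
  · exact Continuous.aestronglyMeasurable (by fun_prop)
  · rw [norm_mul, norm_osc, one_mul, Complex.norm_real, norm_mul, norm_pow]
    simp

lemma hG_rec (n : ℕ) {τ : ℝ} (hτ : 0 < τ) (y : ℝ) :
    (Complex.I * y) * hG n τ y = 2 * τ * hG (n + 1) τ y - n * hG (n - 1) τ y := by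
  have hd : ∀ ξ : ℝ, HasDerivAt (fun ξ : ℝ => Complex.exp (Complex.I * ((y * ξ : ℝ) : ℂ)) *
      ((ξ ^ n * Real.exp (-τ * ξ ^ 2) : ℝ) : ℂ))
      ((Complex.I * y) * (Complex.exp (Complex.I * ((y * ξ : ℝ) : ℂ)) *
        ((ξ ^ n * Real.exp (-τ * ξ ^ 2) : ℝ) : ℂ)) +
      (n * (Complex.exp (Complex.I * ((y * ξ : ℝ) : ℂ)) *
        ((ξ ^ (n - 1) * Real.exp (-τ * ξ ^ 2) : ℝ) : ℂ)) -
       2 * τ * (Complex.exp (Complex.I * ((y * ξ : ℝ) : ℂ)) *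
        ((ξ ^ (n + 1) * Real.exp (-τ * ξ ^ 2) : ℝ) : ℂ)))) ξ := by
    intro ξ
    have h1 : HasDerivAt (fun ξ : ℝ => ξ ^ n * Real.exp (-τ * ξ ^ 2))
        (n * (ξ ^ (n - 1) * Real.exp (-τ * ξ ^ 2)) -
          2 * τ * (ξ ^ (n + 1) * Real.exp (-τ * ξ ^ 2))) ξ := by
      have e := ((hasDerivAt_pow 2 ξ).const_mul (-τ)).exp
      have := (hasDerivAt_pow n ξ).mul e
      refine this.congr_deriv ?_
      push_cast
      ring
    have h2 : HasDerivAt (fun ξ : ℝ => ((y * ξ : ℝ) : ℂ)) (y : ℂ) ξ := by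
      have := ((hasDerivAt_id ξ).const_mul y).ofReal_comp
      simpa using this
    have h3 := (h2.const_mul Complex.I).cexp.mul h1.ofReal_comp
    refine h3.congr_deriv ?_
    push_cast
    ring
  have i0 := hG_integrable n hτ y
  have i1 := hG_integrable (n - 1) hτ y
  have i2 := hG_integrable (n + 1) hτ y
  have j : Integrable fun ξ : ℝ => (n * (Complex.exp (Complex.I * ((y * ξ : ℝ) : ℂ)) *
        ((ξ ^ (n - 1) * Real.exp (-τ * ξ ^ 2) : ℝ) : ℂ)) -
       2 * τ * (Complex.exp (Complex.I * ((y * ξ : ℝ) : ℂ)) *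
        ((ξ ^ (n + 1) * Real.exp (-τ * ξ ^ 2) : ℝ) : ℂ))) :=
    (i1.const_mul (n : ℂ)).sub (i2.const_mul (2 * τ : ℂ))
  have hz := integral_eq_zero_of_hasDerivAt_of_integrable hd
    ((i0.const_mul (Complex.I * y)).add j) i0
  rw [integral_add (i0.const_mul (Complex.I * y)) j,
    integral_sub (i1.const_mul (n : ℂ)) (i2.const_mul (2 * τ : ℂ)),
    integral_const_mul, integral_const_mul, integral_const_mul] at hz
  unfold hG
  linear_combination hz

lemma hG_bound (k : ℕ) : ∀ n : ℕ, ∃ C > (0 : ℝ), ∀ τ : ℝ, 0 < τ → ∀ y : ℝ,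
    |y| ^ k * ‖hG n τ y‖ ≤ C * τ ^ (((k : ℝ) - n - 1) / 2) := by
  induction k with
  | zero =>
    intro n
    obtain ⟨C, hC, h⟩ := mom_le n
    refine ⟨C, hC, fun τ hτ y => ?_⟩
    rw [pow_zero, one_mul]
    have h1 : ‖hG n τ y‖ ≤ ∫ ξ : ℝ, |ξ| ^ n * Real.exp (-τ * ξ ^ 2) := by
      refine norm_integral_le_of_norm_le (mom_integrable n hτ) (Eventually.of_forall fun ξ => ?_)
      rw [norm_mul, norm_osc, one_mul, Complex.norm_real, norm_mul, norm_pow]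
      simp
    refine (h1.trans (h τ hτ)).trans_eq ?_
    congr 2; push_cast; ring
  | succ k ih =>
    intro n
    obtain ⟨C1, hC1, h1⟩ := ih (n + 1)
    have h2 : ∃ C > (0 : ℝ), ∀ τ : ℝ, 0 < τ → ∀ y : ℝ,
        |y| ^ k * (n * ‖hG (n - 1) τ y‖) ≤ C * τ ^ (((k : ℝ) - n) / 2) := by
      rcases n with _ | n
      · exact ⟨1, one_pos, fun τ hτ y => by simp; positivity⟩
      · obtain ⟨C2, hC2, h2⟩ := ih n
        refine ⟨(n + 1) * C2, by positivity, fun τ hτ y => ?_⟩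
        have := h2 τ hτ y
        calc _ = ((n : ℝ) + 1) * (|y| ^ k * ‖hG n τ y‖) := by
              simp only [Nat.add_sub_cancel]; push_cast; ring
          _ ≤ (n + 1) * (C2 * τ ^ (((k : ℝ) - n - 1) / 2)) := by gcongr
          _ = _ := by rw [mul_assoc]; congr 3; push_cast; ring
    obtain ⟨C2, hC2, h2⟩ := h2
    refine ⟨2 * C1 + C2, by positivity, fun τ hτ y => ?_⟩
    have hr := hG_rec n hτ y
    have hr2 : |y| * ‖hG n τ y‖ ≤ 2 * τ * ‖hG (n + 1) τ y‖ + n * ‖hG (n - 1) τ y‖ := by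
      calc |y| * ‖hG n τ y‖ = ‖(Complex.I * y) * hG n τ y‖ := by simp
        _ ≤ _ := by
          rw [hr]
          refine (norm_sub_le _ _).trans_eq ?_
          simp [abs_of_pos hτ]
    calc |y| ^ (k + 1) * ‖hG n τ y‖ = |y| ^ k * (|y| * ‖hG n τ y‖) := by ring
      _ ≤ |y| ^ k * (2 * τ * ‖hG (n + 1) τ y‖ + n * ‖hG (n - 1) τ y‖) := by gcongr
      _ = 2 * τ * (|y| ^ k * ‖hG (n + 1) τ y‖) + |y| ^ k * (n * ‖hG (n - 1) τ y‖) := by ring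
      _ ≤ 2 * τ * (C1 * τ ^ (((k : ℝ) - (n + 1 : ℕ) - 1) / 2)) + C2 * τ ^ (((k : ℝ) - n) / 2) := by
          exact add_le_add (mul_le_mul_of_nonneg_left (h1 τ hτ y) (by positivity)) (h2 τ hτ y)
      _ = 2 * C1 * (τ ^ (1 : ℝ) * τ ^ (((k : ℝ) - (n + 1 : ℕ) - 1) / 2)) +
            C2 * τ ^ (((k : ℝ) - n) / 2) := by rw [Real.rpow_one]; ring
      _ = (2 * C1 + C2) * τ ^ (((k : ℝ) - n) / 2) := by
          rw [← Real.rpow_add hτ, add_mul]; congr 3; push_cast; ring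
      _ = _ := by congr 2; push_cast; ring

/-- two-dimensional oscillatory Gaussian moments -/
def gH (b : ℕ × ℕ) (k : ℕ) (τ : ℝ) (x ξ : ℝ × ℝ) : ℂ :=
  Complex.exp (Complex.I * ((x.1 * ξ.1 + x.2 * ξ.2 : ℝ) : ℂ)) *
    (Complex.I * (ξ.1 : ℂ)) ^ b.1 * (Complex.I * (ξ.2 : ℂ)) ^ b.2 *
    (((ξ.1 ^ 2 + ξ.2 ^ 2) ^ k : ℝ) : ℂ) * ((Real.exp (-τ * (ξ.1 ^ 2 + ξ.2 ^ 2)) : ℝ) : ℂ)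

lemma gH_expand (b : ℕ × ℕ) (k : ℕ) (τ : ℝ) (x ξ : ℝ × ℝ) :
    gH b k τ x ξ = ∑ j ∈ Finset.range (k + 1), (Complex.I ^ (b.1 + b.2) * (k.choose j : ℂ)) *
      ((Complex.exp (Complex.I * ((x.1 * ξ.1 : ℝ) : ℂ)) *
        ((ξ.1 ^ (b.1 + 2 * j) * Real.exp (-τ * ξ.1 ^ 2) : ℝ) : ℂ)) *
      (Complex.exp (Complex.I * ((x.2 * ξ.2 : ℝ) : ℂ)) *
        ((ξ.2 ^ (b.2 + 2 * (k - j)) * Real.exp (-τ * ξ.2 ^ 2) : ℝ) : ℂ))) := by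
  unfold gH
  rw [add_pow, show -τ * (ξ.1 ^ 2 + ξ.2 ^ 2) = -τ * ξ.1 ^ 2 + -τ * ξ.2 ^ 2 by ring, Real.exp_add,
    show Complex.I * ((x.1 * ξ.1 + x.2 * ξ.2 : ℝ) : ℂ) = Complex.I * ((x.1 * ξ.1 : ℝ) : ℂ) +
      Complex.I * ((x.2 * ξ.2 : ℝ) : ℂ) by push_cast; ring, Complex.exp_add]
  rw [Complex.ofReal_sum, Finset.mul_sum, Finset.sum_mul]
  refine Finset.sum_congr rfl fun j _ => ?_
  push_cast
  rw [mul_pow, mul_pow, pow_add, pow_add, pow_add, pow_mul, pow_mul]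
  ring

lemma gH_integral (b : ℕ × ℕ) (k : ℕ) {τ : ℝ} (hτ : 0 < τ) (x : ℝ × ℝ) :
    ∫ ξ, gH b k τ x ξ = ∑ j ∈ Finset.range (k + 1), (Complex.I ^ (b.1 + b.2) * (k.choose j : ℂ)) *
      (hG (b.1 + 2 * j) τ x.1 * hG (b.2 + 2 * (k - j)) τ x.2) := by
  simp_rw [gH_expand]
  rw [integral_finsetSum]
  · refine Finset.sum_congr rfl fun j _ => ?_
    rw [integral_const_mul]
    congr 1
    exact integral_prod_mul (μ := (volume : Measure ℝ)) (ν := (volume : Measure ℝ))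
      (fun ξ : ℝ => Complex.exp (Complex.I * ((x.1 * ξ : ℝ) : ℂ)) *
        ((ξ ^ (b.1 + 2 * j) * Real.exp (-τ * ξ ^ 2) : ℝ) : ℂ))
      (fun ξ : ℝ => Complex.exp (Complex.I * ((x.2 * ξ : ℝ) : ℂ)) *
        ((ξ ^ (b.2 + 2 * (k - j)) * Real.exp (-τ * ξ ^ 2) : ℝ) : ℂ))
  · intro j _
    exact ((hG_integrable _ hτ x.1).mul_prod (hG_integrable _ hτ x.2)).const_mul _

lemma hG_pair (n m : ℕ) : ∃ C > (0 : ℝ), ∀ τ : ℝ, 0 < τ → ∀ x : ℝ × ℝ,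
    ‖hG n τ x.1‖ * ‖hG m τ x.2‖ ≤ C * (τ + x.1 ^ 2 + x.2 ^ 2) ^ (-((n : ℝ) + m + 2) / 2) := by
  obtain ⟨A0, hA0, a0⟩ := hG_bound 0 n
  obtain ⟨A1, hA1, a1⟩ := hG_bound (n + m + 2) n
  obtain ⟨B0, hB0, b0⟩ := hG_bound 0 m
  obtain ⟨B1, hB1, b1⟩ := hG_bound (n + m + 2) m
  refine ⟨3 ^ (n + m + 2) * (A0 * B0 + A1 * B0 + A0 * B1), by positivity, fun τ hτ x => ?_⟩
  set L : ℕ := n + m + 2 with hL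
  have hS : 0 < τ + x.1 ^ 2 + x.2 ^ 2 := by positivity
  rw [neg_div, Real.rpow_neg hS.le, ← div_eq_mul_inv, le_div_iff₀ (by positivity)]
  have hLL : ((n : ℝ) + m + 2) / 2 = (1 / 2 : ℝ) * (L : ℕ) := by rw [hL]; push_cast; ring
  rw [hLL, Real.rpow_mul hS.le, Real.rpow_natCast, ← Real.sqrt_eq_rpow]
  have hsq := Real.sqrt_nonneg τ
  have h1 : √(τ + x.1 ^ 2 + x.2 ^ 2) ≤ √τ + |x.1| + |x.2| := by
    rw [Real.sqrt_le_left (by positivity)]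
    nlinarith [Real.sq_sqrt hτ.le, sq_abs x.1, sq_abs x.2, abs_nonneg x.1, abs_nonneg x.2,
      mul_nonneg hsq (abs_nonneg x.1), mul_nonneg hsq (abs_nonneg x.2),
      mul_nonneg (abs_nonneg x.1) (abs_nonneg x.2)]
  have h2 : (√τ + |x.1| + |x.2|) ^ L ≤ 3 ^ L * (√τ ^ L + |x.1| ^ L + |x.2| ^ L) := by
    have hM : ∀ M, √τ ≤ M → |x.1| ≤ M → |x.2| ≤ M → M ^ L ≤ √τ ^ L + |x.1| ^ L + |x.2| ^ L →
        (√τ + |x.1| + |x.2|) ^ L ≤ 3 ^ L * (√τ ^ L + |x.1| ^ L + |x.2| ^ L) := by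
      intro M u v w h
      calc _ ≤ (3 * M) ^ L := by gcongr; linarith
        _ = 3 ^ L * M ^ L := mul_pow _ _ _
        _ ≤ _ := by gcongr
    have p1 : 0 ≤ √τ ^ L := by positivity
    have p2 : 0 ≤ |x.1| ^ L := by positivity
    have p3 : 0 ≤ |x.2| ^ L := by positivity
    rcases le_total (√τ) |x.1| with h | h <;> rcases le_total |x.1| |x.2| with h' | h' <;>
      rcases le_total (√τ) |x.2| with h'' | h''
    all_goals first
      | exact hM _ (by linarith) (by linarith) (by linarith) (le_add_of_nonneg_left (by positivity))
      | exact hM |x.1| (by linarith) (by linarith) (by linarith) (by linarith)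
      | exact hM (√τ) (by linarith) (by linarith) (by linarith) (by linarith)
  have a0' := a0 τ hτ x.1
  have a1' := a1 τ hτ x.1
  have b0' := b0 τ hτ x.2
  have b1' := b1 τ hτ x.2
  rw [pow_zero, one_mul] at a0' b0'
  have e0 : √τ ^ L * (τ ^ ((((0 : ℕ) : ℝ) - n - 1) / 2) * τ ^ ((((0 : ℕ) : ℝ) - m - 1) / 2)) = 1 := by
    rw [Real.sqrt_eq_rpow, ← Real.rpow_natCast, ← Real.rpow_mul hτ.le, ← Real.rpow_add hτ,
      ← Real.rpow_add hτ]
    refine Eq.trans ?_ (Real.rpow_zero τ)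
    congr 1; rw [hL]; push_cast; ring
  have e1 : τ ^ (((L : ℝ) - n - 1) / 2) * τ ^ ((((0 : ℕ) : ℝ) - m - 1) / 2) = 1 := by
    rw [← Real.rpow_add hτ]
    refine Eq.trans ?_ (Real.rpow_zero τ)
    congr 1; rw [hL]; push_cast; ring
  have e2 : τ ^ ((((0 : ℕ) : ℝ) - n - 1) / 2) * τ ^ (((L : ℝ) - m - 1) / 2) = 1 := by
    rw [← Real.rpow_add hτ]
    refine Eq.trans ?_ (Real.rpow_zero τ)
    congr 1; rw [hL]; push_cast; ring
  have nP := norm_nonneg (hG n τ x.1)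
  have nQ := norm_nonneg (hG m τ x.2)
  have f0 : √τ ^ L * (‖hG n τ x.1‖ * ‖hG m τ x.2‖) ≤ A0 * B0 := by
    calc _ ≤ √τ ^ L * ((A0 * τ ^ ((((0 : ℕ) : ℝ) - n - 1) / 2)) *
          (B0 * τ ^ ((((0 : ℕ) : ℝ) - m - 1) / 2))) :=
          mul_le_mul_of_nonneg_left (mul_le_mul a0' b0' nQ (by positivity)) (by positivity)
      _ = A0 * B0 * (√τ ^ L * (τ ^ ((((0 : ℕ) : ℝ) - n - 1) / 2) *
          τ ^ ((((0 : ℕ) : ℝ) - m - 1) / 2))) := by ring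
      _ = _ := by rw [e0, mul_one]
  have f1 : |x.1| ^ L * ‖hG n τ x.1‖ * ‖hG m τ x.2‖ ≤ A1 * B0 := by
    calc _ ≤ (A1 * τ ^ (((L : ℝ) - n - 1) / 2)) * (B0 * τ ^ ((((0 : ℕ) : ℝ) - m - 1) / 2)) :=
          mul_le_mul a1' b0' nQ (by positivity)
      _ = A1 * B0 * (τ ^ (((L : ℝ) - n - 1) / 2) * τ ^ ((((0 : ℕ) : ℝ) - m - 1) / 2)) := by ring
      _ = _ := by rw [e1, mul_one]
  have f2 : ‖hG n τ x.1‖ * (|x.2| ^ L * ‖hG m τ x.2‖) ≤ A0 * B1 := by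
    calc _ ≤ (A0 * τ ^ ((((0 : ℕ) : ℝ) - n - 1) / 2)) * (B1 * τ ^ (((L : ℝ) - m - 1) / 2)) :=
          mul_le_mul a0' b1' (by positivity) (by positivity)
      _ = A0 * B1 * (τ ^ ((((0 : ℕ) : ℝ) - n - 1) / 2) * τ ^ (((L : ℝ) - m - 1) / 2)) := by ring
      _ = _ := by rw [e2, mul_one]
  calc ‖hG n τ x.1‖ * ‖hG m τ x.2‖ * √(τ + x.1 ^ 2 + x.2 ^ 2) ^ L
      ≤ ‖hG n τ x.1‖ * ‖hG m τ x.2‖ * (3 ^ L * (√τ ^ L + |x.1| ^ L + |x.2| ^ L)) := by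
        refine mul_le_mul_of_nonneg_left (le_trans ?_ h2) (by positivity)
        gcongr
    _ = 3 ^ L * (√τ ^ L * (‖hG n τ x.1‖ * ‖hG m τ x.2‖) + |x.1| ^ L * ‖hG n τ x.1‖ * ‖hG m τ x.2‖ +
          ‖hG n τ x.1‖ * (|x.2| ^ L * ‖hG m τ x.2‖)) := by ring
    _ ≤ _ := by gcongr

lemma gH_bound (b : ℕ × ℕ) (k : ℕ) : ∃ C > (0 : ℝ), ∀ τ : ℝ, 0 < τ → ∀ x : ℝ × ℝ,
    ‖∫ ξ, gH b k τ x ξ‖ ≤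
      C * (τ + x.1 ^ 2 + x.2 ^ 2) ^ (-((b.1 + b.2 + 2 * k + 2 : ℕ) : ℝ) / 2) := by
  choose C hC h using fun j : ℕ => hG_pair (b.1 + 2 * j) (b.2 + 2 * (k - j))
  refine ⟨∑ j ∈ Finset.range (k + 1), (k.choose j : ℝ) * C j, ?_, fun τ hτ x => ?_⟩
  · refine Finset.sum_pos (fun j hj => ?_) ⟨0, by simp⟩
    have : 0 < k.choose j := Nat.choose_pos (Nat.lt_succ_iff.1 (Finset.mem_range.1 hj))
    have := hC j
    positivity
  rw [gH_integral b k hτ, Finset.sum_mul]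
  refine (norm_sum_le _ _).trans (Finset.sum_le_sum fun j hj => ?_)
  have hj' : j ≤ k := Nat.lt_succ_iff.1 (Finset.mem_range.1 hj)
  rw [norm_mul, norm_mul, norm_pow, Complex.norm_I, one_pow, one_mul, norm_mul, mul_assoc]
  have := h j τ hτ x
  rw [show -(((b.1 + 2 * j : ℕ) : ℝ) + ((b.2 + 2 * (k - j) : ℕ) : ℝ) + 2) / 2 =
    -((b.1 + b.2 + 2 * k + 2 : ℕ) : ℝ) / 2 by push_cast [Nat.cast_sub hj']; ring] at this
  rw [Complex.norm_natCast]
  gcongr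



lemma gauss_prim : ∃ F : ℝ → ℝ, (∀ x, HasDerivAt F (Real.exp (-x ^ 2)) x) ∧
    Tendsto F atTop (𝓝 (√π)) ∧ Tendsto F atBot (𝓝 0) := by
  have hi : Integrable fun x : ℝ => Real.exp (-x ^ 2) := by
    simpa using integrable_exp_neg_mul_sq (b := 1) one_pos
  have hv : ∫ x : ℝ, Real.exp (-x ^ 2) = √π := by
    simpa using integral_gaussian 1
  have hc : Continuous fun x : ℝ => Real.exp (-x ^ 2) := by fun_prop
  have h1 := intervalIntegral_tendsto_integral_Ioi 0 hi.integrableOn (tendsto_id (α := ℝ))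
  have h2 := intervalIntegral_tendsto_integral_Iic 0 hi.integrableOn (tendsto_id (α := ℝ))
  refine ⟨fun x => (∫ u in (0:ℝ)..x, Real.exp (-u ^ 2)) + ∫ u in Set.Iic (0:ℝ), Real.exp (-u ^ 2),
    fun x => ?_, ?_, ?_⟩
  · exact (intervalIntegral.integral_hasDerivAt_right (hc.intervalIntegrable _ _)
      (hc.stronglyMeasurableAtFilter _ _) hc.continuousAt).add_const _
  · have h3 := h1.add_const (∫ u in Set.Iic (0:ℝ), Real.exp (-u ^ 2))
    rw [add_comm (∫ x in Set.Ioi (0:ℝ), Real.exp (-x ^ 2)),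
      intervalIntegral.integral_Iic_add_Ioi hi.integrableOn hi.integrableOn, hv] at h3
    exact h3
  · have h3 := h2.neg.add_const (∫ u in Set.Iic (0:ℝ), Real.exp (-u ^ 2))
    rw [neg_add_cancel] at h3
    refine h3.congr fun x => ?_
    rw [intervalIntegral.integral_symm]; simp

lemma sqrt_tendsto_zero : Tendsto (fun s : ℝ => √s) (𝓝[>] 0) (𝓝[>] 0) := by
  refine tendsto_nhdsWithin_iff.2 ⟨?_, ?_⟩
  · have := Real.continuous_sqrt.tendsto 0
    rw [Real.sqrt_zero] at this
    exact this.mono_left nhdsWithin_le_nhds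
  · filter_upwards [self_mem_nhdsWithin] with s hs
    exact Real.sqrt_pos.2 hs

lemma inv_sqrt_zero {z : ℝ} (hz : 0 < z) :
    Tendsto (fun s : ℝ => z / (2 * √s)) (𝓝[>] 0) atTop := by
  have h := (tendsto_inv_nhdsGT_zero.comp sqrt_tendsto_zero).const_mul_atTop
    (show 0 < z / 2 by positivity)
  refine h.congr fun s => ?_
  simp only [Function.comp]
  rw [div_mul_eq_div_div, div_eq_mul_inv (z / 2)]

lemma inv_sqrt_top (z : ℝ) : Tendsto (fun s : ℝ => z / (2 * √s)) atTop (𝓝 0) :=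
  (Real.tendsto_sqrt_atTop.const_mul_atTop (show (0:ℝ) < 2 by norm_num)).const_div_atTop z

lemma sub_deriv {F : ℝ → ℝ} (hF : ∀ x, HasDerivAt F (Real.exp (-x ^ 2)) x) (a z s : ℝ)
    (hs : 0 < s) : HasDerivAt (fun s => F (a * √s - z / (2 * √s)))
      (Real.exp (a * z) * (Real.exp (-a ^ 2 * s - z ^ 2 / (4 * s)) *
        (a / (2 * √s) + z / (4 * s * √s)))) s := by
  have hq : 0 < √s := Real.sqrt_pos.2 hs
  have h1 := Real.hasDerivAt_sqrt hs.ne'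
  have h2 : HasDerivAt (fun s => a * √s - z / (2 * √s)) (a / (2 * √s) + z / (4 * s * √s)) s := by
    have h3 := (h1.const_mul a).sub ((hasDerivAt_const s z).div (h1.const_mul 2) (by positivity))
    refine h3.congr_deriv ?_
    obtain ⟨q, rfl⟩ : ∃ q, q = √s := ⟨_, rfl⟩
    have hs2 : s = √s ^ 2 := (Real.sq_sqrt hs.le).symm
    generalize √s = q at *
    subst hs2
    field_simp
    ring
  refine ((hF _).comp s h2).congr_deriv ?_
  rw [← mul_assoc, ← Real.exp_add]
  congr 2
  have hs2 : s = √s ^ 2 := (Real.sq_sqrt hs.le).symm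
  generalize √s = q at *
  subst hs2
  field_simp
  ring

lemma cont_patch {f : ℝ → ℝ} {l : ℝ} (h : Tendsto f (𝓝[>] 0) (𝓝 l)) :
    ContinuousWithinAt (Function.update f 0 l) (Set.Ici 0) 0 := by
  rw [continuousWithinAt_update_same]
  convert h using 2
  ext s; simp [lt_iff_le_and_ne, eq_comm]

lemma deriv_patch {f : ℝ → ℝ} {l d s : ℝ} (hs : 0 < s) (h : HasDerivAt f d s) :
    HasDerivAt (Function.update f 0 l) d s := by
  refine h.congr_of_eventuallyEq ?_
  filter_upwards [lt_mem_nhds hs] with u hu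
  exact Function.update_of_ne hu.ne' _ _

lemma top_patch {f : ℝ → ℝ} {l m : ℝ} (h : Tendsto f atTop (𝓝 m)) :
    Tendsto (Function.update f 0 l) atTop (𝓝 m) := by
  refine h.congr' ?_
  filter_upwards [eventually_gt_atTop 0] with u hu
  exact (Function.update_of_ne hu.ne' _ _).symm

lemma sub_both {a z : ℝ} (ha : 0 < a) (hz : 0 < z) :
    IntegrableOn (fun s => Real.exp (-a ^ 2 * s - z ^ 2 / (4 * s)) * (a / (2 * √s))) (Set.Ioi 0) ∧
    IntegrableOn (fun s => Real.exp (-a ^ 2 * s - z ^ 2 / (4 * s)) * (z / (4 * s * √s)))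
      (Set.Ioi 0) ∧
    ∫ s in Set.Ioi (0:ℝ), Real.exp (-a ^ 2 * s - z ^ 2 / (4 * s)) * (a / (2 * √s)) =
      √π * Real.exp (-(a * z)) / 2 ∧
    ∫ s in Set.Ioi (0:ℝ), Real.exp (-a ^ 2 * s - z ^ 2 / (4 * s)) * (z / (4 * s * √s)) =
      √π * Real.exp (-(a * z)) / 2 := by
  obtain ⟨F, hF, hFt, hFb⟩ := gauss_prim
  have s0 : Tendsto (fun s : ℝ => a * √s) (𝓝[>] 0) (𝓝 0) := by
    have := (sqrt_tendsto_zero.mono_right nhdsWithin_le_nhds).const_mul a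
    simpa using this
  have s1 : Tendsto (fun s : ℝ => a * √s) atTop atTop := Real.tendsto_sqrt_atTop.const_mul_atTop ha
  -- minus branch
  have m0 : Tendsto (fun s => F (a * √s - z / (2 * √s))) (𝓝[>] 0) (𝓝 0) := by
    refine hFb.comp ?_
    have := s0.add_atBot (tendsto_neg_atTop_atBot.comp (inv_sqrt_zero hz))
    simpa [sub_eq_add_neg, Function.comp_def] using this
  have m1 : Tendsto (fun s => F (a * √s - z / (2 * √s))) atTop (𝓝 (√π)) := by
    refine hFt.comp ?_
    have := s1.atTop_add (inv_sqrt_top z).neg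
    simpa [sub_eq_add_neg, Function.comp_def] using this
  have p0 : Tendsto (fun s => F (a * √s - (-z) / (2 * √s))) (𝓝[>] 0) (𝓝 (√π)) := by
    refine hFt.comp ?_
    have := s0.add_atTop (inv_sqrt_zero hz)
    simpa [neg_div, Function.comp_def] using this
  have p1 : Tendsto (fun s => F (a * √s - (-z) / (2 * √s))) atTop (𝓝 (√π)) := by
    refine hFt.comp ?_
    have := s1.atTop_add (inv_sqrt_top z)
    simpa [neg_div, Function.comp_def] using this
  have dm : ∀ s ∈ Set.Ioi (0:ℝ), _ := fun s hs => deriv_patch (l := 0) hs (sub_deriv hF a z s hs)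
  have dp : ∀ s ∈ Set.Ioi (0:ℝ), _ := fun s hs => deriv_patch (l := √π) hs (sub_deriv hF a (-z) s hs)
  have pos : ∀ s ∈ Set.Ioi (0:ℝ), 0 ≤ Real.exp (a * z) *
      (Real.exp (-a ^ 2 * s - z ^ 2 / (4 * s)) * (a / (2 * √s) + z / (4 * s * √s))) := by
    intro s hs
    have : 0 < s := hs
    positivity
  have im := integrableOn_Ioi_deriv_of_nonneg (cont_patch m0) dm pos (top_patch m1)
  have vm := integral_Ioi_of_hasDerivAt_of_tendsto (cont_patch m0) dm im (top_patch m1)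
  have im' : IntegrableOn (fun s => Real.exp (-a ^ 2 * s - z ^ 2 / (4 * s)) *
      (a / (2 * √s) + z / (4 * s * √s))) (Set.Ioi 0) := by
    have := im.const_mul (Real.exp (a * z))⁻¹
    refine this.congr (Eventually.of_forall fun s => ?_)
    simp only
    rw [inv_mul_cancel_left₀ (Real.exp_pos _).ne']
  have i1 : IntegrableOn (fun s => Real.exp (-a ^ 2 * s - z ^ 2 / (4 * s)) * (a / (2 * √s)))
      (Set.Ioi 0) := by
    refine Integrable.mono' im' (by fun_prop) ?_
    filter_upwards [ae_restrict_mem measurableSet_Ioi] with s hs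
    have hs : 0 < s := hs
    rw [Real.norm_of_nonneg (by positivity)]
    gcongr
    exact le_add_of_nonneg_right (by positivity)
  have i2 : IntegrableOn (fun s => Real.exp (-a ^ 2 * s - z ^ 2 / (4 * s)) * (z / (4 * s * √s)))
      (Set.Ioi 0) := by
    refine Integrable.mono' im' (by fun_prop) ?_
    filter_upwards [ae_restrict_mem measurableSet_Ioi] with s hs
    have hs : 0 < s := hs
    rw [Real.norm_of_nonneg (by positivity)]
    gcongr
    exact le_add_of_nonneg_left (by positivity)
  have e2 : ∀ s, Real.exp (a * -z) * (Real.exp (-a ^ 2 * s - (-z) ^ 2 / (4 * s)) *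
        (a / (2 * √s) + -z / (4 * s * √s))) = Real.exp (a * -z) *
      (Real.exp (-a ^ 2 * s - z ^ 2 / (4 * s)) * (a / (2 * √s)) -
       Real.exp (-a ^ 2 * s - z ^ 2 / (4 * s)) * (z / (4 * s * √s))) := by
    intro s; rw [neg_sq, neg_div]; ring
  have ip : IntegrableOn (fun s => Real.exp (a * -z) * (Real.exp (-a ^ 2 * s - (-z) ^ 2 / (4 * s)) *
        (a / (2 * √s) + -z / (4 * s * √s)))) (Set.Ioi 0) := by
    simp_rw [e2]
    exact (i1.sub i2).const_mul _
  have vp := integral_Ioi_of_hasDerivAt_of_tendsto (cont_patch p0) dp ip (top_patch p1)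
  simp_rw [e2] at vp
  simp_rw [mul_add] at vm
  rw [integral_const_mul, integral_sub i1 i2, Function.update_self, sub_self] at vp
  have vm2 : Real.exp (a * z) * ∫ s in Set.Ioi (0:ℝ),
      (Real.exp (-a ^ 2 * s - z ^ 2 / (4 * s)) * (a / (2 * √s)) +
       Real.exp (-a ^ 2 * s - z ^ 2 / (4 * s)) * (z / (4 * s * √s))) = √π := by
    rw [← integral_const_mul]
    simp_rw [mul_add]
    rw [vm, Function.update_self, sub_zero]
  rw [integral_add i1 i2] at vm2
  have w1 := (mul_eq_zero.1 vp).resolve_left (Real.exp_pos _).ne'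
  have w2 : (∫ s in Set.Ioi (0:ℝ), Real.exp (-a ^ 2 * s - z ^ 2 / (4 * s)) * (a / (2 * √s))) +
     ∫ s in Set.Ioi (0:ℝ), Real.exp (-a ^ 2 * s - z ^ 2 / (4 * s)) * (z / (4 * s * √s)) =
      √π * Real.exp (-(a * z)) := by
    rw [Real.exp_neg, ← vm2, mul_comm, inv_mul_cancel_left₀ (Real.exp_pos _).ne']
  exact ⟨i1, i2, by linarith, by linarith⟩



lemma gH_shift (b : ℕ × ℕ) (k : ℕ) (t s : ℝ) (x ξ : ℝ × ℝ) :
    gH b k (t + s) x ξ =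
      gH b k t x ξ * ((Real.exp (-(√(ξ.1 ^ 2 + ξ.2 ^ 2)) ^ 2 * s) : ℝ) : ℂ) := by
  unfold gH
  rw [Real.sq_sqrt (by positivity), show -(t + s) * (ξ.1 ^ 2 + ξ.2 ^ 2) =
    -t * (ξ.1 ^ 2 + ξ.2 ^ 2) + -(ξ.1 ^ 2 + ξ.2 ^ 2) * s by ring, Real.exp_add, Complex.ofReal_mul]
  ring

lemma kd_main (b : ℕ × ℕ) (γ k : ℕ) (t : ℝ) (x : V3) (w : ℝ → ℝ) (hwm : Measurable w)
    (hw0 : ∀ s, 0 < s → 0 ≤ w s)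
    (hint : ∀ a, 0 < a → IntegrableOn (fun s => w s * Real.exp (-a ^ 2 * s)) (Set.Ioi 0))
    (hval : ∀ a : ℝ, 0 < a → (a : ℂ) ^ ((γ : ℤ) - 1) * (1 / 2 : ℂ) *
        ((Real.exp (-a * |x.2|) : ℝ) : ℂ) =
      (((a ^ 2) ^ k : ℝ) : ℂ) * ((∫ s in Set.Ioi (0 : ℝ), w s * Real.exp (-a ^ 2 * s) : ℝ) : ℂ)) :
    |KD b γ t x| ≤ ((2 * π) ^ 2)⁻¹ *
      ‖∫ s in Set.Ioi (0 : ℝ), (w s : ℂ) * ∫ ξ, gH b k (t + s) x.1 ξ‖ := by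
  obtain ⟨J, hJ⟩ : ∃ J : ℝ × ℝ → ℂ, J = fun ξ : ℝ × ℝ =>
      Complex.exp (Complex.I * ((x.1.1 * ξ.1 + x.1.2 * ξ.2 : ℝ) : ℂ)) *
        (Complex.I * (ξ.1 : ℂ)) ^ b.1 * (Complex.I * (ξ.2 : ℂ)) ^ b.2 *
        ((Real.sqrt (ξ.1 ^ 2 + ξ.2 ^ 2) : ℂ) ^ ((γ : ℤ) - 1)) * (1 / 2 : ℂ) *
        ((Real.exp (-t * (ξ.1 ^ 2 + ξ.2 ^ 2)) : ℝ) : ℂ) *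
        ((Real.exp (-(Real.sqrt (ξ.1 ^ 2 + ξ.2 ^ 2)) * |x.2|) : ℝ) : ℂ) := ⟨_, rfl⟩
  have hKD : KD b γ t x = (((2 * π) ^ 2)⁻¹ : ℝ) * (∫ ξ, J ξ).re := by rw [hJ]; rfl
  have hle : |KD b γ t x| ≤ ((2 * π) ^ 2)⁻¹ * ‖∫ ξ, J ξ‖ := by
    rw [hKD, abs_mul, abs_of_nonneg (by positivity)]
    gcongr
    exact Complex.abs_re_le_norm _
  have hae : ∀ᵐ ξ : ℝ × ℝ, 0 < √(ξ.1 ^ 2 + ξ.2 ^ 2) := by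
    have h0 : ∀ᵐ ξ : ℝ × ℝ, ξ ≠ 0 := by simp [ae_iff]
    filter_upwards [h0] with ξ hξ
    rw [Real.sqrt_pos]
    by_contra hcon
    have e1 : ξ.1 = 0 := by nlinarith [sq_nonneg ξ.1, sq_nonneg ξ.2]
    have e2 : ξ.2 = 0 := by nlinarith [sq_nonneg ξ.1, sq_nonneg ξ.2]
    exact hξ (Prod.ext e1 e2)
  have hJv : ∀ ξ : ℝ × ℝ, 0 < √(ξ.1 ^ 2 + ξ.2 ^ 2) →
      J ξ = gH b k t x.1 ξ * ((∫ s in Set.Ioi (0 : ℝ), w s *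
        Real.exp (-(√(ξ.1 ^ 2 + ξ.2 ^ 2)) ^ 2 * s) : ℝ) : ℂ) := by
    intro ξ hξ
    have h := hval _ hξ
    rw [Real.sq_sqrt (by positivity)] at h
    rw [Real.sq_sqrt (by positivity), hJ]
    unfold gH
    linear_combination (Complex.exp (Complex.I * ((x.1.1 * ξ.1 + x.1.2 * ξ.2 : ℝ) : ℂ)) *
        (Complex.I * (ξ.1 : ℂ)) ^ b.1 * (Complex.I * (ξ.2 : ℂ)) ^ b.2 *
        ((Real.exp (-t * (ξ.1 ^ 2 + ξ.2 ^ 2)) : ℝ) : ℂ)) * h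
  have hfe : ∀ (ξ : ℝ × ℝ) (s : ℝ), (w s : ℂ) * gH b k (t + s) x.1 ξ = gH b k t x.1 ξ *
      ((w s * Real.exp (-(√(ξ.1 ^ 2 + ξ.2 ^ 2)) ^ 2 * s) : ℝ) : ℂ) := by
    intro ξ s
    rw [gH_shift]; push_cast; ring
  have hJi : ∀ ξ : ℝ × ℝ, 0 < √(ξ.1 ^ 2 + ξ.2 ^ 2) →
      J ξ = ∫ s in Set.Ioi (0 : ℝ), (w s : ℂ) * gH b k (t + s) x.1 ξ := by
    intro ξ hξ
    simp_rw [hfe]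
    rw [integral_const_mul, integral_complex_ofReal, hJv ξ hξ]
  by_cases hJint : Integrable J
  swap
  · rw [integral_undef hJint, norm_zero, mul_zero] at hle
    exact hle.trans (by positivity)
  refine hle.trans_eq ?_
  congr 2
  have hm : AEStronglyMeasurable (fun p : (ℝ × ℝ) × ℝ => (w p.2 : ℂ) * gH b k (t + p.2) x.1 p.1)
      ((volume : Measure (ℝ × ℝ)).prod (volume.restrict (Set.Ioi (0 : ℝ)))) := by
    have c : Continuous fun p : (ℝ × ℝ) × ℝ => gH b k (t + p.2) x.1 p.1 := by
      unfold gH; fun_prop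
    exact ((Complex.measurable_ofReal.comp (hwm.comp measurable_snd)).mul
      c.measurable).aestronglyMeasurable
  have hprod : Integrable (fun p : (ℝ × ℝ) × ℝ => (w p.2 : ℂ) * gH b k (t + p.2) x.1 p.1)
      ((volume : Measure (ℝ × ℝ)).prod (volume.restrict (Set.Ioi (0 : ℝ)))) := by
    rw [integrable_prod_iff hm]
    constructor
    · filter_upwards [hae] with ξ hξ
      simp only [hfe]
      exact ((hint _ hξ).ofReal (𝕜 := ℂ)).const_mul _
    · refine hJint.norm.congr ?_
      filter_upwards [hae] with ξ hξ
      simp only [hfe]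
      simp_rw [norm_mul]
      rw [integral_const_mul, hJv ξ hξ, norm_mul]
      congr 1
      rw [Complex.norm_real, Real.norm_of_nonneg]
      · refine setIntegral_congr_fun measurableSet_Ioi fun s hs => ?_
        have := hw0 s hs
        rw [Complex.norm_real, Real.norm_of_nonneg (by positivity)]
      · refine setIntegral_nonneg measurableSet_Ioi fun s hs => ?_
        have := hw0 s hs
        positivity
  have hsw := integral_integral_swap (f := fun (ξ : ℝ × ℝ) (s : ℝ) =>
    (w s : ℂ) * gH b k (t + s) x.1 ξ) hprod
  rw [integral_congr_ae (hae.mono fun ξ hξ => hJi ξ hξ), hsw]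
  simp_rw [integral_const_mul]

/-- the bound on KD by an s-integral -/
lemma kd_main2 (b : ℕ × ℕ) (k : ℕ) : ∃ C > (0 : ℝ), ∀ (γ : ℕ) (t : ℝ), 0 < t →
    ∀ (x : V3) (w B : ℝ → ℝ), Measurable w → (∀ s, 0 < s → 0 ≤ w s) →
    (∀ a, 0 < a → IntegrableOn (fun s => w s * Real.exp (-a ^ 2 * s)) (Set.Ioi 0)) →
    (∀ a : ℝ, 0 < a → (a : ℂ) ^ ((γ : ℤ) - 1) * (1 / 2 : ℂ) *
        ((Real.exp (-a * |x.2|) : ℝ) : ℂ) =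
      (((a ^ 2) ^ k : ℝ) : ℂ) * ((∫ s in Set.Ioi (0 : ℝ), w s * Real.exp (-a ^ 2 * s) : ℝ) : ℂ)) →
    IntegrableOn B (Set.Ioi 0) →
    (∀ s, 0 < s → w s * (t + s + x.1.1 ^ 2 + x.1.2 ^ 2) ^
      (-((b.1 + b.2 + 2 * k + 2 : ℕ) : ℝ) / 2) ≤ B s) →
    |KD b γ t x| ≤ C * ∫ s in Set.Ioi (0 : ℝ), B s := by
  obtain ⟨C, hC, h⟩ := gH_bound b k
  refine ⟨((2 * π) ^ 2)⁻¹ * C, by positivity, fun γ t ht x w B hwm hw0 hint hval hB hle => ?_⟩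
  refine (kd_main b γ k t x w hwm hw0 hint hval).trans ?_
  rw [mul_assoc, ← integral_const_mul]
  refine mul_le_mul_of_nonneg_left ?_ (by positivity)
  refine norm_integral_le_of_norm_le (hB.const_mul C) ?_
  filter_upwards [ae_restrict_mem measurableSet_Ioi] with s hs
  have hs : 0 < s := hs
  have h0 := hw0 s hs
  rw [norm_mul, Complex.norm_real, Real.norm_of_nonneg h0]
  calc _ ≤ w s * (C * (t + s + x.1.1 ^ 2 + x.1.2 ^ 2) ^
      (-((b.1 + b.2 + 2 * k + 2 : ℕ) : ℝ) / 2)) :=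
        mul_le_mul_of_nonneg_left (h (t + s) (by positivity) x.1) h0
    _ = C * (w s * (t + s + x.1.1 ^ 2 + x.1.2 ^ 2) ^
      (-((b.1 + b.2 + 2 * k + 2 : ℕ) : ℝ) / 2)) := by ring
    _ ≤ _ := mul_le_mul_of_nonneg_left (hle s hs) hC.le



lemma exp_poly (n : ℕ) : ∃ C > (0 : ℝ), ∀ y : ℝ, 0 ≤ y → Real.exp (-(y / 4)) * (1 + y) ^ n ≤ C := by
  refine ⟨4 ^ n * n.factorial * Real.exp (1 / 4), by positivity, fun y hy => ?_⟩
  have h := Real.pow_div_factorial_le_exp (x := (1 + y) / 4) (by positivity) n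
  rw [div_le_iff₀ (by positivity), div_pow, div_le_iff₀ (by positivity)] at h
  calc _ ≤ Real.exp (-(y / 4)) * (Real.exp ((1 + y) / 4) * n.factorial * 4 ^ n) := by gcongr
    _ = 4 ^ n * n.factorial * (Real.exp (-(y / 4)) * Real.exp ((1 + y) / 4)) := by ring
    _ = _ := by rw [← Real.exp_add]; congr 2; ring

lemma key_pt (L j : ℕ) : ∃ C > (0 : ℝ), ∀ X s z : ℝ, 0 < s → s ≤ X →
    Real.exp (-(z ^ 2 / (4 * s))) * (1 + z ^ 2 / s) ^ j * X ^ (-(L : ℝ) / 2) ≤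
      C * (X + z ^ 2) ^ (-(L : ℝ) / 2) := by
  obtain ⟨C, hC, h⟩ := exp_poly (j + L)
  refine ⟨C, hC, fun X s z hs hX => ?_⟩
  have hX0 : 0 < X := hs.trans_le hX
  have hy : 0 ≤ z ^ 2 / s := by positivity
  have h1 := h _ hy
  rw [neg_div, Real.rpow_neg hX0.le, Real.rpow_neg (by positivity), ← div_eq_mul_inv,
    ← div_eq_mul_inv, div_le_div_iff₀ (by positivity) (by positivity)]
  have h2 : (X + z ^ 2) ^ ((L : ℝ) / 2) ≤ X ^ ((L : ℝ) / 2) * (1 + z ^ 2 / s) ^ L := by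
    have e1 : X + z ^ 2 ≤ X * (1 + z ^ 2 / s) := by
      have : z ^ 2 ≤ X * (z ^ 2 / s) := by
        rw [mul_div_assoc', le_div_iff₀ hs]
        nlinarith [sq_nonneg z]
      linarith
    calc _ ≤ (X * (1 + z ^ 2 / s)) ^ ((L : ℝ) / 2) :=
          Real.rpow_le_rpow (by positivity) e1 (by positivity)
      _ = X ^ ((L : ℝ) / 2) * (1 + z ^ 2 / s) ^ ((L : ℝ) / 2) :=
          Real.mul_rpow hX0.le (by positivity)
      _ ≤ _ := by
          rw [← Real.rpow_natCast (1 + z ^ 2 / s) L]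
          refine mul_le_mul_of_nonneg_left (Real.rpow_le_rpow_of_exponent_le (by linarith) ?_)
            (by positivity)
          have : (0 : ℝ) ≤ L := L.cast_nonneg
          linarith
  rw [show z ^ 2 / s / 4 = z ^ 2 / (4 * s) by rw [div_div, mul_comm]] at h1
  calc _ ≤ Real.exp (-(z ^ 2 / (4 * s))) * (1 + z ^ 2 / s) ^ j *
        (X ^ ((L : ℝ) / 2) * (1 + z ^ 2 / s) ^ L) := by gcongr
    _ = (Real.exp (-(z ^ 2 / (4 * s))) * (1 + z ^ 2 / s) ^ (j + L)) * X ^ ((L : ℝ) / 2) := by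
        rw [pow_add]; ring
    _ ≤ _ := by gcongr

lemma arct {E : ℝ} (hE : 0 < E) : IntegrableOn (fun s => 1 / (√s * (E + s))) (Set.Ioi 0) ∧
    ∫ s in Set.Ioi (0 : ℝ), 1 / (√s * (E + s)) = π / √E := by
  have hq : 0 < √E := Real.sqrt_pos.2 hE
  have hd : ∀ s ∈ Set.Ioi (0 : ℝ), HasDerivAt (fun s => 2 / √E * Real.arctan (√s / √E))
      (1 / (√s * (E + s))) s := by
    intro s hs
    have hs : 0 < s := hs
    have h := (((Real.hasDerivAt_sqrt hs.ne').div_const (√E)).arctan).const_mul (2 / √E)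
    refine h.congr_deriv ?_
    have hqs : 0 < √s := Real.sqrt_pos.2 hs
    have e1 : E = √E ^ 2 := (Real.sq_sqrt hE.le).symm
    have e2 : s = √s ^ 2 := (Real.sq_sqrt hs.le).symm
    generalize √s = u at *
    generalize √E = v at *
    subst e1 e2
    field_simp
  have hc : ContinuousWithinAt (fun s => 2 / √E * Real.arctan (√s / √E)) (Set.Ici 0) 0 := by
    apply Continuous.continuousWithinAt
    have := Real.continuous_arctan
    fun_prop
  have ht : Tendsto (fun s => 2 / √E * Real.arctan (√s / √E)) atTop (𝓝 (2 / √E * (π / 2))) := by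
    refine Tendsto.const_mul _ ?_
    exact (Real.tendsto_arctan_atTop.mono_right nhdsWithin_le_nhds).comp
      (Real.tendsto_sqrt_atTop.atTop_div_const hq)
  have hp : ∀ s ∈ Set.Ioi (0 : ℝ), 0 ≤ 1 / (√s * (E + s)) := by
    intro s hs
    have hs : 0 < s := hs
    positivity
  refine ⟨integrableOn_Ioi_deriv_of_nonneg hc hd hp ht, ?_⟩
  rw [integral_Ioi_of_hasDerivAt_of_nonneg hc hd hp ht]
  simp

lemma kS_eq (t : ℝ) (x : V3) : kS t x = t + x.1.1 ^ 2 + x.1.2 ^ 2 + x.2 ^ 2 := rfl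

lemma KD_even (b : ℕ × ℕ) (k : ℕ) : ∃ C > (0 : ℝ), ∀ t, 0 < t → ∀ x : V3, x.2 ≠ 0 →
    |KD b (2 * k) t x| ≤ C * kS t x ^ (-(((b.1 + b.2 + 2 * k : ℕ) : ℝ) + 1) / 2) := by
  obtain ⟨C1, hC1, h1⟩ := kd_main2 b k
  obtain ⟨C2, hC2, h2⟩ := key_pt (b.1 + b.2 + 2 * k + 2) 0
  refine ⟨C1 * (C2 / (2 * √π) * π), by positivity, fun t ht x hx => ?_⟩
  have hE := kS_pos ht x
  have hz : 0 < |x.2| := abs_pos.2 hx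
  obtain ⟨ai, av⟩ := arct hE
  have hpi : 0 < √π := Real.sqrt_pos.2 Real.pi_pos
  obtain ⟨N, hN⟩ : ∃ N : ℕ, N = b.1 + b.2 + 2 * k := ⟨_, rfl⟩
  have h := h1 (2 * k) t ht x (fun s => Real.exp (-(x.2 ^ 2 / (4 * s))) / (2 * √π * √s))
    (fun s => C2 / (2 * √π) * kS t x ^ (-(N : ℝ) / 2) * (1 / (√s * (kS t x + s))))
    (by fun_prop) (fun s hs => by positivity) ?_ ?_ (ai.const_mul _) ?_
  · rw [integral_const_mul, av] at h
    refine h.trans_eq ?_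
    rw [← hN, Real.sqrt_eq_rpow (kS t x), show -((N : ℝ) + 1) / 2 = -(N : ℝ) / 2 - 1 / 2 by ring,
      Real.rpow_sub hE]
    ring
  · intro a ha
    refine ((sub_both ha hz).1.const_mul (1 / (a * √π))).congr ?_
    filter_upwards [ae_restrict_mem measurableSet_Ioi] with s hs
    have hqs : 0 < √s := Real.sqrt_pos.2 hs
    rw [sq_abs, sub_eq_add_neg, Real.exp_add]
    field_simp
  · intro a ha
    have e : ∫ s in Set.Ioi (0 : ℝ), Real.exp (-(x.2 ^ 2 / (4 * s))) / (2 * √π * √s) *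
        Real.exp (-a ^ 2 * s) = Real.exp (-(a * |x.2|)) / (2 * a) := by
      have : ∀ s ∈ Set.Ioi (0 : ℝ), Real.exp (-(x.2 ^ 2 / (4 * s))) / (2 * √π * √s) *
        Real.exp (-a ^ 2 * s) = (1 / (a * √π)) *
          (Real.exp (-a ^ 2 * s - |x.2| ^ 2 / (4 * s)) * (a / (2 * √s))) := by
        intro s hs
        have hqs : 0 < √s := Real.sqrt_pos.2 hs
        rw [sq_abs, sub_eq_add_neg, Real.exp_add]
        field_simp
      rw [setIntegral_congr_fun measurableSet_Ioi this, integral_const_mul, (sub_both ha hz).2.2.1]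
      field_simp
    rw [e]
    have ha' : (a : ℂ) ≠ 0 := by exact_mod_cast ha.ne'
    rw [zpow_sub₀ ha', show ((2 * k : ℕ) : ℤ) = ((2 * k : ℕ) : ℤ) from rfl, zpow_natCast, zpow_one,
      neg_mul]
    push_cast
    rw [← pow_mul]
    field_simp
  · intro s hs
    have hqs : 0 < √s := Real.sqrt_pos.2 hs
    have h3 := h2 (t + s + x.1.1 ^ 2 + x.1.2 ^ 2) s x.2 hs (by nlinarith [sq_nonneg x.1.1, sq_nonneg x.1.2])
    rw [pow_zero, mul_one, show t + s + x.1.1 ^ 2 + x.1.2 ^ 2 + x.2 ^ 2 = kS t x + s by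
      rw [kS_eq]; ring] at h3
    have h4 : (kS t x + s) ^ (-((b.1 + b.2 + 2 * k + 2 : ℕ) : ℝ) / 2) ≤
        kS t x ^ (-(N : ℝ) / 2) * (1 / (kS t x + s)) := by
      rw [show -((b.1 + b.2 + 2 * k + 2 : ℕ) : ℝ) / 2 = -(N : ℝ) / 2 - 1 by
        rw [hN]; push_cast; ring, Real.rpow_sub (by positivity), Real.rpow_one, mul_one_div]
      gcongr ?_ / _
      refine Real.rpow_le_rpow_of_nonpos hE (by linarith) ?_
      have : (0 : ℝ) ≤ N := N.cast_nonneg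
      linarith
    calc _ = 1 / (2 * √π * √s) * (Real.exp (-(x.2 ^ 2 / (4 * s))) *
          (t + s + x.1.1 ^ 2 + x.1.2 ^ 2) ^ (-((b.1 + b.2 + 2 * k + 2 : ℕ) : ℝ) / 2)) := by ring
      _ ≤ 1 / (2 * √π * √s) * (C2 * (kS t x ^ (-(N : ℝ) / 2) * (1 / (kS t x + s)))) := by
          refine mul_le_mul_of_nonneg_left (h3.trans ?_) (by positivity)
          gcongr
      _ = _ := by field_simp

lemma KD_odd (b : ℕ × ℕ) (k : ℕ) : ∃ C > (0 : ℝ), ∀ t, 0 < t → ∀ x : V3, x.2 ≠ 0 →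
    |KD b (2 * k + 1) t x| ≤ C * kS t x ^ (-(((b.1 + b.2 + (2 * k + 1) : ℕ) : ℝ) + 1) / 2) := by
  obtain ⟨C1, hC1, h1⟩ := kd_main2 b k
  obtain ⟨C2, hC2, h2⟩ := key_pt (b.1 + b.2 + 2 * k + 2) 1
  refine ⟨C1 * (C2 / (4 * √π) * π), by positivity, fun t ht x hx => ?_⟩
  have hE := kS_pos ht x
  have hz : 0 < |x.2| := abs_pos.2 hx
  have hz2 : 0 < x.2 ^ 2 := by positivity
  obtain ⟨ai, av⟩ := arct hz2
  have hpi : 0 < √π := Real.sqrt_pos.2 Real.pi_pos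
  obtain ⟨M, hM⟩ : ∃ M : ℝ, M = -((b.1 + b.2 + 2 * k + 2 : ℕ) : ℝ) / 2 := ⟨_, rfl⟩
  have hM0 : M ≤ 0 := by
    rw [hM]
    have : (0 : ℝ) ≤ ((b.1 + b.2 + 2 * k + 2 : ℕ) : ℝ) := Nat.cast_nonneg _
    linarith
  have h := h1 (2 * k + 1) t ht x
    (fun s => |x.2| * Real.exp (-(x.2 ^ 2 / (4 * s))) / (4 * √π * s * √s))
    (fun s => C2 / (4 * √π) * kS t x ^ M * |x.2| * (1 / (√s * (x.2 ^ 2 + s))))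
    (by fun_prop) (fun s hs => by positivity) ?_ ?_ (ai.const_mul _) ?_
  · rw [integral_const_mul, av, Real.sqrt_sq_eq_abs] at h
    refine h.trans_eq ?_
    rw [show -(((b.1 + b.2 + (2 * k + 1) : ℕ) : ℝ) + 1) / 2 = M by rw [hM]; push_cast; ring]
    field_simp
  · intro a ha
    refine ((sub_both ha hz).2.1.const_mul (1 / √π)).congr ?_
    filter_upwards [ae_restrict_mem measurableSet_Ioi] with s hs
    have hs : 0 < s := hs
    have hqs : 0 < √s := Real.sqrt_pos.2 hs
    rw [sq_abs, sub_eq_add_neg, Real.exp_add]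
    field_simp
  · intro a ha
    have e : ∫ s in Set.Ioi (0 : ℝ), |x.2| * Real.exp (-(x.2 ^ 2 / (4 * s))) / (4 * √π * s * √s) *
        Real.exp (-a ^ 2 * s) = Real.exp (-(a * |x.2|)) / 2 := by
      have : ∀ s ∈ Set.Ioi (0 : ℝ), |x.2| * Real.exp (-(x.2 ^ 2 / (4 * s))) / (4 * √π * s * √s) *
        Real.exp (-a ^ 2 * s) = (1 / √π) *
          (Real.exp (-a ^ 2 * s - |x.2| ^ 2 / (4 * s)) * (|x.2| / (4 * s * √s))) := by
        intro s hs
        have hs : 0 < s := hs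
        have hqs : 0 < √s := Real.sqrt_pos.2 hs
        rw [sq_abs, sub_eq_add_neg, Real.exp_add]
        field_simp
      rw [setIntegral_congr_fun measurableSet_Ioi this, integral_const_mul, (sub_both ha hz).2.2.2]
      field_simp
    rw [e]
    rw [show ((2 * k + 1 : ℕ) : ℤ) - 1 = ((2 * k : ℕ) : ℤ) by push_cast; ring, zpow_natCast, neg_mul]
    push_cast
    rw [← pow_mul]
    ring
  · intro s hs
    have hqs : 0 < √s := Real.sqrt_pos.2 hs
    have h3 := h2 (t + s + x.1.1 ^ 2 + x.1.2 ^ 2) s x.2 hs (by nlinarith [sq_nonneg x.1.1, sq_nonneg x.1.2])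
    rw [pow_one, show t + s + x.1.1 ^ 2 + x.1.2 ^ 2 + x.2 ^ 2 = kS t x + s by
      rw [kS_eq]; ring, ← hM] at h3
    rw [← hM]
    have h4 : (kS t x + s) ^ M ≤ kS t x ^ M :=
      Real.rpow_le_rpow_of_nonpos hE (by linarith) hM0
    calc _ = |x.2| / (4 * √π * √s * (x.2 ^ 2 + s)) * (Real.exp (-(x.2 ^ 2 / (4 * s))) *
          (1 + x.2 ^ 2 / s) * (t + s + x.1.1 ^ 2 + x.1.2 ^ 2) ^ M) := by
            field_simp
            ring
      _ ≤ |x.2| / (4 * √π * √s * (x.2 ^ 2 + s)) * (C2 * kS t x ^ M) := by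
          refine mul_le_mul_of_nonneg_left (h3.trans ?_) (by positivity)
          gcongr
      _ = _ := by field_simp

lemma KD_bound (b : ℕ × ℕ) (γ : ℕ) : ∃ C > (0 : ℝ), ∀ t, 0 < t → ∀ x : V3, x.2 ≠ 0 →
    |KD b γ t x| ≤ C * kS t x ^ (-(((b.1 + b.2 + γ : ℕ) : ℝ) + 1) / 2) := by
  obtain ⟨k, rfl | rfl⟩ := Nat.even_or_odd' γ
  · exact KD_even b k
  · exact KD_odd b k


/-- anisotropic decay estimates for the kernel ∇_h^β(−Δ_h)^{γ/2}K. -/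
theorem kernel_decay (p q : ℝ≥0∞) (hp : 1 ≤ p) (hq : 1 ≤ q)
    (β : ℕ × ℕ) (γ m : ℕ)
    (hcond : (2 : ℝ) * p.toReal⁻¹ + q.toReal⁻¹ - 1 + (m : ℝ) <
      ((β.1 + β.2 + γ : ℕ) : ℝ)) :
    (∃ C > (0 : ℝ), ∀ t : ℝ, 0 < t →
      LhLv p q (fun x => wxh x ^ m * KD β γ t x) ≤
        ENNReal.ofReal
          (C * t ^ (-(1 - p.toReal⁻¹) - (1 / 2 : ℝ) * (1 - q.toReal⁻¹) -
            (((β.1 + β.2 + γ : ℕ) : ℝ) - 2) / 2 + (m : ℝ) / 2))) ∧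
    (∀ p₁ p₂ q₁ q₂ : ℝ≥0∞, 1 ≤ p₁ → 1 ≤ p₂ → 1 ≤ q₁ → 1 ≤ q₂ →
      p₁ ≤ p → p₂ ≤ p → q₁ ≤ q → q₂ ≤ q →
      (0 : ℝ) < (p₁.toReal⁻¹ - p.toReal⁻¹) + (1 / 2 : ℝ) * (q₁.toReal⁻¹ - q.toReal⁻¹) +
        (((β.1 + β.2 + γ : ℕ) : ℝ) - 3) / 2 →
      (0 : ℝ) < (p₂.toReal⁻¹ - p.toReal⁻¹) + (1 / 2 : ℝ) * (q₂.toReal⁻¹ - q.toReal⁻¹) +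
        (((β.1 + β.2 + γ : ℕ) : ℝ) - 2) / 2 →
      ∃ C > (0 : ℝ), ∀ t : ℝ, 0 < t → ∀ f : V3 → ℝ,
        LhLv p₁ q₁ f < ∞ → LhLv p₂ q₂ (fun x => wxh x * f x) < ∞ →
          LhLv p q (fun x => wxh x * conv3 (KD β γ t) f x) ≤
            ENNReal.ofReal
                (C * t ^ (-(p₁.toReal⁻¹ - p.toReal⁻¹) -
                  (1 / 2 : ℝ) * (q₁.toReal⁻¹ - q.toReal⁻¹) -
                  (((β.1 + β.2 + γ : ℕ) : ℝ) - 3) / 2)) * LhLv p₁ q₁ f +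
            ENNReal.ofReal
                (C * t ^ (-(p₂.toReal⁻¹ - p.toReal⁻¹) -
                  (1 / 2 : ℝ) * (q₂.toReal⁻¹ - q.toReal⁻¹) -
                  (((β.1 + β.2 + γ : ℕ) : ℝ) - 2) / 2)) *
              LhLv p₂ q₂ (fun x => wxh x * f x)) := by
  obtain ⟨C₀, hC₀, hK⟩ := KD_bound β γ
  refine ⟨part_one hp hq (β.1 + β.2 + γ) m (KD β γ) C₀ hC₀ hK hcond, ?_⟩
  intro p₁ p₂ q₁ q₂ hp₁ hp₂ hq₁ hq₂ hpp₁ hpp₂ hqq₁ hqq₂ h1 h2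
  obtain ⟨C, hC, h⟩ := part_two hp hq (β.1 + β.2 + γ) (KD β γ) C₀ hC₀ hK p₁ p₂ q₁ q₂
    hp₁ hp₂ hq₁ hq₂ hpp₁ hpp₂ hqq₁ hqq₂ h1 h2
  exact ⟨C, hC, fun t ht f _ _ => h t ht f⟩

end
end
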